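/- There exists a constant c₀ > 0 such that every u ∈ H₀(ℝ) (i.e. u locally absolutely continuous with u' ∈ L²(ℝ) and Q̃·u ∈ L²(ℝ)) satisfying the two orthogonality conditions ∫φ₀·u = 0 and ∫Q̃²·H̃³·u = 0 obeys the coercivity estimate ∫(u')² − (2/3)·∫Q̃³·u² ≥ c₀·( ∫(u')² + ∫Q̃²·u² ). -/

import Mathlib

open Real MeasureTheory Filter

noncomputable def Qs (x : ℝ) : ℝ := (3/2) * (1 / Real.cosh (x/2))^2
noncomputable def Hs (x : ℝ) : ℝ := Real.tanh (x/2)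
noncomputable def alphaFn (x : ℝ) : ℝ := (1/3) * (Real.sinh x + x)
noncomputable def alphaInv : ℝ → ℝ := Function.invFun alphaFn
noncomputable def Qt (x : ℝ) : ℝ := Qs (alphaInv x)
noncomputable def Ht (x : ℝ) : ℝ := Hs (alphaInv x)
noncomputable def Vpot (x : ℝ) : ℝ := 2 * (Qt x)^2 * (1 - Qt x)

open Set intervalIntegral Topology

/-- `u` is locally absolutely continuous with density `g`. -/
structure HasDensity (u g : ℝ → ℝ) : Prop where
  intervalIntegrable : ∀ a b : ℝ, IntervalIntegrable g volume a b
  sub_eq : ∀ a b : ℝ, u b - u a = ∫ t in a..b, g t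

namespace HasDensity

variable {u g c c' : ℝ → ℝ} {p r : ℝ}

lemma eq_integral (h : HasDensity u g) (a : ℝ) : u = fun x => u a + ∫ t in a..x, g t := by
  ext x
  rw [← h.sub_eq a x]
  ring

lemma absolutelyContinuous (h : HasDensity u g) (a b : ℝ) :
    AbsolutelyContinuousOnInterval u a b := by
  have h1 := (h.intervalIntegrable a b).absolutelyContinuousOnInterval_intervalIntegral
    (c := a) left_mem_uIcc
  have h2 : AbsolutelyContinuousOnInterval (fun _ : ℝ => u a) a b :=
    ((LipschitzWith.const (u a)).lipschitzOnWith (s := uIcc a b)).absolutelyContinuousOnInterval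
  rw [h.eq_integral a]
  exact h2.add h1

lemma continuous (h : HasDensity u g) : Continuous u := by
  rw [h.eq_integral 0]
  exact continuous_const.add (continuous_primitive h.intervalIntegrable 0)

lemma ae_hasDerivAt (h : HasDensity u g) (a b : ℝ) :
    ∀ᵐ x, x ∈ uIcc a b → HasDerivAt u (g x) x := by
  filter_upwards [(h.intervalIntegrable a b).ae_hasDerivAt_integral] with x hx hxm
  rw [h.eq_integral a]
  exact (hx hxm a left_mem_uIcc).const_add _

/-- Fundamental theorem of calculus for the product of a `C¹` function and `u`. -/
lemma integral_mul (h : HasDensity u g) (hpr : p ≤ r)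
    (hc : ∀ x ∈ Icc p r, HasDerivAt c (c' x) x) (hc' : ContinuousOn c' (Icc p r)) :
    ∫ x in p..r, (c' x * u x + c x * g x) = c r * u r - c p * u p := by
  obtain ⟨K, hK⟩ := isCompact_Icc.exists_bound_of_continuousOn hc'
  have hlip : LipschitzOnWith K.toNNReal c (uIcc p r) := by
    rw [uIcc_of_le hpr]
    refine (convex_Icc p r).lipschitzOnWith_of_nnnorm_hasDerivWithin_le
      (fun x hx => (hc x hx).hasDerivWithinAt) (fun x hx => ?_)
    rw [← NNReal.coe_le_coe, coe_nnnorm]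
    exact (hK x hx).trans (Real.le_coe_toNNReal K)
  rw [← hlip.absolutelyContinuousOnInterval.integral_deriv_mul_eq_sub
    (h.absolutelyContinuous p r)]
  refine integral_congr_ae ?_
  filter_upwards [h.ae_hasDerivAt p r] with x hx hxm
  have hxm' := uIoc_subset_uIcc hxm
  rw [(hx hxm').deriv, (hc x (by rwa [uIcc_of_le hpr] at hxm')).deriv]

lemma sq (h : HasDensity u g) : HasDensity (fun x => u x ^ 2) (fun x => 2 * u x * g x) where
  intervalIntegrable a b :=
    (h.intervalIntegrable a b).continuousOn_mul (by have := h.continuous; fun_prop)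
  sub_eq a b := by
    have := (h.absolutelyContinuous a b).integral_deriv_mul_eq_sub (h.absolutelyContinuous a b)
    rw [show u b ^ 2 - u a ^ 2 = u b * u b - u a * u a by ring, ← this]
    refine integral_congr_ae ?_
    filter_upwards [h.ae_hasDerivAt a b] with x hx hxm
    rw [(hx (uIoc_subset_uIcc hxm)).deriv]
    ring

/-- Fundamental theorem of calculus for the product of a `C¹` function and `u²`. -/
lemma integral_mul_sq (h : HasDensity u g) (hpr : p ≤ r)
    (hc : ∀ x ∈ Icc p r, HasDerivAt c (c' x) x) (hc' : ContinuousOn c' (Icc p r)) :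
    ∫ x in p..r, (c' x * u x ^ 2 + c x * (2 * u x * g x)) = c r * u r ^ 2 - c p * u p ^ 2 :=
  h.sq.integral_mul hpr hc hc'

lemma comp_neg (h : HasDensity u g) : HasDensity (fun x => u (-x)) (fun x => -g (-x)) where
  intervalIntegrable a b := by
    have h1 : IntervalIntegrable (fun x => g (-x)) volume a b := by
      simpa using (h.intervalIntegrable (-a) (-b)).comp_sub_left 0
    exact h1.neg
  sub_eq a b := by
    rw [intervalIntegral.integral_neg, intervalIntegral.integral_comp_neg, ← h.sub_eq]
    ring

lemma add {v k : ℝ → ℝ} (h : HasDensity u g) (h' : HasDensity v k) :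
    HasDensity (fun x => u x + v x) (fun x => g x + k x) where
  intervalIntegrable a b := (h.intervalIntegrable a b).add (h'.intervalIntegrable a b)
  sub_eq a b := by
    rw [intervalIntegral.integral_add (h.intervalIntegrable a b) (h'.intervalIntegrable a b),
      ← h.sub_eq, ← h'.sub_eq]
    ring

lemma const_mul (h : HasDensity u g) (k : ℝ) :
    HasDensity (fun x => k * u x) (fun x => k * g x) where
  intervalIntegrable a b := (h.intervalIntegrable a b).const_mul k
  sub_eq a b := by
    rw [intervalIntegral.integral_const_mul, ← h.sub_eq]
    ring

end HasDensity

/-- If `u` is the antiderivative of `g` in the sense of the (possibly degenerate) Bochner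
integral, then either `g` is locally integrable or `u` is constant. -/
lemma hasDensity_or_const {u g : ℝ → ℝ} (h : ∀ a b : ℝ, u b - u a = ∫ t in a..b, g t) :
    HasDensity u g ∨ ∃ k, ∀ x, u x = k := by
  by_cases hg : LocallyIntegrable g volume
  · exact Or.inl ⟨fun a b => (hg.integrableOn_isCompact isCompact_uIcc).intervalIntegrable, h⟩
  right
  obtain ⟨z, hz⟩ : ∃ z, ¬ IntegrableAtFilter g (𝓝 z) volume := by
    simpa [LocallyIntegrable] using hg
  have hbad : ∀ x y, x < z → z < y → u y = u x := by
    intro x y hx hy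
    have h1 : ¬ IntervalIntegrable g volume x y := fun hi => hz
      ⟨Ioc x y, Ioc_mem_nhds hx hy, (intervalIntegrable_iff_integrableOn_Ioc_of_le
        (hx.trans hy).le).1 hi⟩
    have := h x y
    rw [intervalIntegral.integral_undef h1] at this
    linarith
  have hlt : ∀ x, x < z → u x = u (z + 1) := fun x hx => (hbad x (z + 1) hx (by linarith)).symm
  have hgt : ∀ y, z < y → u y = u (z + 1) := fun y hy =>
    (hbad (z - 1) y (by linarith) hy).trans (hlt _ (by linarith))
  have hmid : u z = u (z + 1) := by
    by_cases hi : IntervalIntegrable g volume (z - 1) z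
    · have hcont : ContinuousWithinAt (fun x => u (z - 1) + ∫ t in (z - 1)..x, g t)
          (Icc (z - 1) z) z := by
        refine continuousWithinAt_const.add ?_
        have := continuousOn_primitive_interval'
          (f := g) (a := z - 1) (b₁ := z - 1) (b₂ := z) hi left_mem_uIcc
        rw [uIcc_of_le (by linarith)] at this
        exact this z (by constructor <;> linarith)
      have heq : (fun x => u (z - 1) + ∫ t in (z - 1)..x, g t) = u := by
        ext x
        rw [← h]
        ring
      rw [heq] at hcont
      have h2 : Tendsto u (𝓝[<] z) (𝓝 (u z)) :=
        (hcont.mono_of_mem_nhdsWithin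
          (mem_of_superset (Ioo_mem_nhdsLT (show z - 1 < z by linarith)) Ioo_subset_Icc_self))
      have h3 : Tendsto u (𝓝[<] z) (𝓝 (u (z + 1))) := by
        refine tendsto_const_nhds.congr' ?_
        filter_upwards [self_mem_nhdsWithin] with x hx
        exact (hlt x hx).symm
      exact tendsto_nhds_unique h2 h3
    · have := h (z - 1) z
      rw [intervalIntegral.integral_undef hi, hlt (z - 1) (by linarith)] at this
      linarith
  refine ⟨u (z + 1), fun x => ?_⟩
  rcases lt_trichotomy x z with hx | rfl | hx
  · exact hlt x hx
  · exact hmid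
  · exact hgt x hx

section DistortedSoliton

lemma strictMono_alphaFn : StrictMono alphaFn := fun x y h => by
  have := Real.sinh_lt_sinh.2 h
  unfold alphaFn
  linarith

lemma continuous_alphaFn : Continuous alphaFn := by
  unfold alphaFn
  fun_prop

lemma surjective_alphaFn : Function.Surjective alphaFn := by
  refine continuous_alphaFn.surjective ?_ ?_
  · refine tendsto_atTop_mono' _ ?_ (tendsto_id.const_mul_atTop (show (0:ℝ) < 1 / 3 by norm_num))
    filter_upwards [eventually_ge_atTop 0] with x hx
    have := Real.sinh_nonneg_iff.2 hx
    simp only [id, alphaFn]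
    linarith
  · refine tendsto_atBot_mono' _ ?_ (tendsto_id.const_mul_atBot (show (0:ℝ) < 1 / 3 by norm_num))
    filter_upwards [eventually_le_atBot 0] with x hx
    have := Real.sinh_nonpos_iff.2 hx
    simp only [id, alphaFn]
    linarith

lemma alphaInv_alphaFn (y : ℝ) : alphaInv (alphaFn y) = y :=
  Function.leftInverse_invFun strictMono_alphaFn.injective y

lemma alphaFn_alphaInv (x : ℝ) : alphaFn (alphaInv x) = x :=
  Function.rightInverse_invFun surjective_alphaFn x

lemma strictMono_alphaInv : StrictMono alphaInv := fun x y h => by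
  rwa [← strictMono_alphaFn.lt_iff_lt, alphaFn_alphaInv, alphaFn_alphaInv]

lemma alphaInv_neg (x : ℝ) : alphaInv (-x) = -alphaInv x := by
  apply strictMono_alphaFn.injective
  have : alphaFn (-alphaInv x) = -alphaFn (alphaInv x) := by
    simp only [alphaFn, Real.sinh_neg]
    ring
  rw [this, alphaFn_alphaInv, alphaFn_alphaInv]

lemma alphaInv_zero : alphaInv 0 = 0 := by
  have := alphaInv_neg 0
  rw [neg_zero] at this
  linarith

lemma continuous_alphaInv : Continuous alphaInv := by
  refine strictMono_alphaInv.monotone.continuous_of_surjective fun y => ?_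
  exact ⟨alphaFn y, alphaInv_alphaFn y⟩

lemma Qs_pos (y : ℝ) : 0 < Qs y := by
  have := Real.cosh_pos (y / 2)
  unfold Qs
  positivity

lemma hasDerivAt_alphaFn (y : ℝ) : HasDerivAt alphaFn (Qs y)⁻¹ y := by
  have h := ((Real.hasDerivAt_sinh y).add (hasDerivAt_id y)).const_mul (1 / 3 : ℝ)
  have h2 : (Qs y)⁻¹ = 1 / 3 * (Real.cosh y + 1) := by
    have h3 : Real.cosh y = 2 * Real.cosh (y / 2) ^ 2 - 1 := by
      have h4 := Real.cosh_two_mul (y / 2)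
      rw [Real.sinh_sq, show 2 * (y / 2) = y by ring] at h4
      linarith
    have := Real.cosh_pos (y / 2)
    rw [h3, Qs]
    field_simp
    ring
  rw [h2]
  exact h

lemma hasDerivAt_alphaInv (x : ℝ) : HasDerivAt alphaInv (Qt x) x := by
  have := HasDerivAt.of_local_left_inverse (f := alphaFn) (g := alphaInv) (a := x)
    continuous_alphaInv.continuousAt (hasDerivAt_alphaFn _) (inv_ne_zero (Qs_pos _).ne')
    (Eventually.of_forall alphaFn_alphaInv)
  rwa [inv_inv] at this

lemma Qt_pos (x : ℝ) : 0 < Qt x := Qs_pos _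

lemma Ht_sq (x : ℝ) : Ht x ^ 2 = 1 - 2 / 3 * Qt x := by
  have h := Real.cosh_pos (alphaInv x / 2)
  have h2 := Real.cosh_sq (alphaInv x / 2)
  rw [Ht, Hs, Qt, Qs, Real.tanh_eq_sinh_div_cosh]
  field_simp
  linarith

lemma Qt_le (x : ℝ) : Qt x ≤ 3 / 2 := by
  nlinarith [Ht_sq x, sq_nonneg (Ht x)]

lemma hasDerivAt_Ht (x : ℝ) : HasDerivAt Ht (Qt x ^ 2 / 3) x := by
  have hy := (hasDerivAt_alphaInv x).div_const 2
  have hc := (Real.cosh_pos (alphaInv x / 2)).ne'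
  have h := (hy.sinh).div hy.cosh hc
  have heq : Ht = fun x => Real.sinh (alphaInv x / 2) / Real.cosh (alphaInv x / 2) := by
    ext x
    rw [Ht, Hs, Real.tanh_eq_sinh_div_cosh]
  rw [heq]
  refine h.congr_deriv ?_
  have h2 := Real.cosh_sq (alphaInv x / 2)
  rw [div_eq_iff (by positivity)]
  have h3 : Qt x * Real.cosh (alphaInv x / 2) ^ 2 = 3 / 2 := by
    rw [Qt, Qs]
    field_simp
  linear_combination Qt x / 2 * h2 - (Qt x / 3) * h3

lemma hasDerivAt_Qt (x : ℝ) : HasDerivAt Qt (-(Ht x * Qt x ^ 2)) x := by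
  have h := (((hasDerivAt_Ht x).pow 2).const_sub 1).const_mul (3 / 2 : ℝ)
  have heq : Qt = fun x => 3 / 2 * (1 - Ht x ^ 2) := by
    ext x
    rw [Ht_sq]
    ring
  refine (h.congr_of_eventuallyEq (Eventually.of_forall (congrFun heq))).congr_deriv ?_
  push_cast
  ring

lemma continuous_Ht : Continuous Ht :=
  continuous_iff_continuousAt.2 fun x => (hasDerivAt_Ht x).continuousAt

lemma continuous_Qt : Continuous Qt :=
  continuous_iff_continuousAt.2 fun x => (hasDerivAt_Qt x).continuousAt

lemma Ht_neg (x : ℝ) : Ht (-x) = -Ht x := by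
  rw [Ht, Ht, Hs, Hs, alphaInv_neg, neg_div, Real.tanh_neg]

lemma Qt_neg (x : ℝ) : Qt (-x) = Qt x := by
  rw [Qt, Qt, Qs, Qs, alphaInv_neg, neg_div, Real.cosh_neg]

lemma Ht_zero : Ht 0 = 0 := by
  simp [Ht, Hs, alphaInv_zero]

lemma strictMono_Ht : StrictMono Ht :=
  strictMono_of_hasDerivAt_pos hasDerivAt_Ht fun x => by have := Qt_pos x; positivity

lemma Ht_pos {x : ℝ} (hx : 0 < x) : 0 < Ht x := by
  simpa [Ht_zero] using strictMono_Ht hx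

lemma Ht_nonneg {x : ℝ} (hx : 0 ≤ x) : 0 ≤ Ht x := by
  simpa [Ht_zero] using strictMono_Ht.monotone hx

lemma Ht_lt_one (x : ℝ) : Ht x < 1 := by
  nlinarith [Ht_sq x, Qt_pos x]

lemma one_sub_Ht_le {x : ℝ} (hx : 0 ≤ x) : 1 - Ht x ≤ 2 / 3 * Qt x := by
  nlinarith [Ht_sq x, Ht_nonneg hx, Ht_lt_one x]

/-- The even solution of `f'' = -(2/3) Q̃³ f` with `f 0 = 1`. -/
noncomputable def evenSol (x : ℝ) : ℝ := 1 - Ht x * (alphaInv x / 2 + 3 / 4 * x)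

/-- The derivative of `evenSol`. -/
noncomputable def evenSolDeriv (x : ℝ) : ℝ :=
  -(Qt x ^ 2 / 3 * (alphaInv x / 2 + 3 / 4 * x) + Ht x * (Qt x / 2 + 3 / 4))

lemma hasDerivAt_evenSol (x : ℝ) : HasDerivAt evenSol (evenSolDeriv x) x := by
  have h := ((hasDerivAt_Ht x).mul (((hasDerivAt_alphaInv x).div_const 2).add
    ((hasDerivAt_id x).const_mul (3 / 4)))).const_sub 1
  refine h.congr_deriv ?_
  simp [evenSolDeriv]

lemma hasDerivAt_evenSolDeriv (x : ℝ) :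
    HasDerivAt evenSolDeriv (-(2 / 3 * Qt x ^ 3) * evenSol x) x := by
  have h := (((((hasDerivAt_Qt x).pow 2).div_const 3).mul (((hasDerivAt_alphaInv x).div_const 2).add
    ((hasDerivAt_id x).const_mul (3 / 4)))).add ((hasDerivAt_Ht x).mul
      (((hasDerivAt_Qt x).div_const 2).add_const (3 / 4)))).neg
  refine h.congr_deriv ?_
  have h2 := Ht_sq x
  simp [evenSol]
  linear_combination (Qt x ^ 2 / 2) * h2

lemma hasDerivAt_Ht_deriv (x : ℝ) :
    HasDerivAt (fun x => Qt x ^ 2 / 3) (-(2 / 3 * Qt x ^ 3) * Ht x) x := by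
  refine (((hasDerivAt_Qt x).pow 2).div_const 3).congr_deriv ?_
  simp
  ring

lemma wronskian_evenSol (x : ℝ) :
    evenSol x * (Qt x ^ 2 / 3) - evenSolDeriv x * Ht x = 3 / 4 := by
  rw [evenSol, evenSolDeriv]
  linear_combination (Qt x / 2 + 3 / 4) * Ht_sq x

lemma continuous_evenSol : Continuous evenSol :=
  continuous_iff_continuousAt.2 fun x => (hasDerivAt_evenSol x).continuousAt

lemma continuous_evenSolDeriv : Continuous evenSolDeriv :=
  continuous_iff_continuousAt.2 fun x => (hasDerivAt_evenSolDeriv x).continuousAt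

lemma evenSol_zero : evenSol 0 = 1 := by simp [evenSol, Ht_zero]

lemma evenSolDeriv_zero : evenSolDeriv 0 = 0 := by simp [evenSolDeriv, Ht_zero, alphaInv_zero]

lemma evenSolDeriv_neg {x : ℝ} (hx : 0 < x) : evenSolDeriv x < 0 := by
  have h1 := Ht_pos hx
  have h2 := Qt_pos x
  have h3 : 0 < alphaInv x := by simpa [alphaInv_zero] using strictMono_alphaInv hx
  rw [evenSolDeriv, neg_lt_zero]
  positivity

lemma strictAntiOn_evenSol : StrictAntiOn evenSol (Ici 0) :=
  strictAntiOn_of_deriv_neg (convex_Ici 0) continuous_evenSol.continuousOn fun x hx => by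
    rw [(hasDerivAt_evenSol x).deriv]
    exact evenSolDeriv_neg (by simpa using hx)

lemma alphaInv_le {x : ℝ} (hx : 0 ≤ x) : alphaInv x ≤ 3 / 2 * x := by
  have h : AntitoneOn (fun x => alphaInv x - 3 / 2 * x) (Ici 0) := by
    have hd : ∀ x, HasDerivAt (fun x => alphaInv x - 3 / 2 * x) (Qt x - 3 / 2 * 1) x := fun x =>
      (hasDerivAt_alphaInv x).sub ((hasDerivAt_id x).const_mul _)
    refine antitoneOn_of_deriv_nonpos (convex_Ici 0)
      (fun x _ => (hd x).continuousAt.continuousWithinAt)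
      (fun x _ => (hd x).differentiableAt.differentiableWithinAt) fun x _ => ?_
    rw [(hd x).deriv]
    linarith [Qt_le x]
  have := h self_mem_Ici hx hx
  simp [alphaInv_zero] at this
  linarith

/-- The zero `X` of `evenSol` satisfies `H̃(X) ≤ 2/3` and `X ≥ 2 / (3 H̃(X))`. -/
lemma exists_evenSol_eq_zero :
    ∃ X > 0, evenSol X = 0 ∧ Ht X ≤ 2 / 3 ∧ 2 ≤ 3 * X * Ht X := by
  set x₂ := alphaFn (Real.log 5) with hx₂
  have hlog : 1.2 ≤ Real.log 5 := by
    have h1 : Real.log 4 = 2 * Real.log 2 := by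
      rw [show (4:ℝ) = 2 ^ 2 by norm_num, Real.log_pow]
      norm_num
    have h2 : Real.log 4 ≤ Real.log 5 := Real.log_le_log (by norm_num) (by norm_num)
    linarith [Real.log_two_gt_d9]
  have hsinh : Real.sinh (Real.log 5) = 12 / 5 := by
    rw [Real.sinh_eq, Real.exp_neg, Real.exp_log (by norm_num)]
    norm_num
  have hHt : Ht x₂ = 2 / 3 := by
    have h1 : Real.exp (Real.log 5 / 2) * Real.exp (Real.log 5 / 2) = 5 := by
      rw [← Real.exp_add, add_halves, Real.exp_log (by norm_num)]
    rw [Ht, Hs, hx₂, alphaInv_alphaFn, Real.tanh_eq_sinh_div_cosh, Real.sinh_eq, Real.cosh_eq,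
      Real.exp_neg]
    have h2 := Real.exp_pos (Real.log 5 / 2)
    rw [div_eq_iff (by positivity)]
    field_simp
    linarith
  have hx₂pos : 0 < x₂ := by
    simp only [hx₂, alphaFn, hsinh]
    linarith
  have hf : evenSol x₂ ≤ 0 := by
    rw [evenSol, hHt, hx₂, alphaInv_alphaFn, alphaFn, hsinh]
    linarith
  obtain ⟨X, hX, hX0⟩ := intermediate_value_Icc' hx₂pos.le continuous_evenSol.continuousOn
    (show (0:ℝ) ∈ Icc (evenSol x₂) (evenSol 0) from ⟨hf, by simp [evenSol_zero]⟩)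
  have hXpos : 0 < X := by
    refine lt_of_le_of_ne hX.1 fun h => ?_
    rw [← h, evenSol_zero] at hX0
    exact one_ne_zero hX0
  refine ⟨X, hXpos, hX0, hHt ▸ strictMono_Ht.monotone hX.2, ?_⟩
  have h1 := Ht_pos hXpos
  have h2 := alphaInv_le hX.1
  rw [evenSol] at hX0
  nlinarith

end DistortedSoliton

section HalfLine

variable {u g a : ℝ → ℝ} {p r : ℝ}

lemma HasDensity.intervalIntegrable_sq_sub (h : HasDensity u g) (hpr : p ≤ r)
    (hg : IntervalIntegrable (fun x => g x ^ 2) volume p r) (ha : ContinuousOn a (Icc p r)) :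
    IntervalIntegrable (fun x => (g x - a x * u x) ^ 2) volume p r := by
  have hu := h.continuous.continuousOn (s := uIcc p r)
  rw [← uIcc_of_le hpr] at ha
  have h1 : IntervalIntegrable (fun x => (2 * a x * u x) * g x) volume p r :=
    (h.intervalIntegrable p r).continuousOn_mul (by fun_prop)
  have h2 : IntervalIntegrable (fun x => (a x * u x) ^ 2) volume p r :=
    ContinuousOn.intervalIntegrable (by fun_prop)
  refine ((hg.sub h1).add h2).congr_ae (ae_of_all _ fun x => ?_)
  simp
  ring

/-- Completing the square in the energy by means of a positive solution `w` of `w'' = -V w`. -/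
lemma HasDensity.energy_eq (h : HasDensity u g) (hpr : p ≤ r)
    (hg : IntervalIntegrable (fun x => g x ^ 2) volume p r) {w w' V : ℝ → ℝ}
    (hw : ∀ x ∈ Icc p r, HasDerivAt w (w' x) x)
    (hw' : ∀ x ∈ Icc p r, HasDerivAt w' (-V x * w x) x)
    (hV : ContinuousOn V (Icc p r)) (hpos : ∀ x ∈ Icc p r, 0 < w x) :
    ∫ x in p..r, (g x ^ 2 - V x * u x ^ 2) =
      (∫ x in p..r, (g x - w' x / w x * u x) ^ 2)
        + w' r / w r * u r ^ 2 - w' p / w p * u p ^ 2 := by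
  have hwc : ContinuousOn w (Icc p r) := fun x hx => (hw x hx).continuousAt.continuousWithinAt
  have hwc' : ContinuousOn w' (Icc p r) := fun x hx => (hw' x hx).continuousAt.continuousWithinAt
  have hne : ∀ x ∈ Icc p r, w x ≠ 0 := fun x hx => (hpos x hx).ne'
  have ha : ContinuousOn (fun x => w' x / w x) (Icc p r) := hwc'.div hwc hne
  have hder : ∀ x ∈ Icc p r,
      HasDerivAt (fun x => w' x / w x) (-V x - (w' x / w x) ^ 2) x := fun x hx => by
    refine ((hw' x hx).div (hw x hx) (hne x hx)).congr_deriv ?_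
    field_simp [hne x hx]
  have hder' : ContinuousOn (fun x => -V x - (w' x / w x) ^ 2) (Icc p r) := hV.neg.sub (ha.pow 2)
  have key := h.integral_mul_sq hpr hder hder'
  have hsq := h.intervalIntegrable_sq_sub hpr hg ha
  have hu := h.continuous.continuousOn (s := uIcc p r)
  have h_int : IntervalIntegrable (fun x => (-V x - (w' x / w x) ^ 2) * u x ^ 2 +
      w' x / w x * (2 * u x * g x)) volume p r := by
    rw [← uIcc_of_le hpr] at ha hder'
    refine IntervalIntegrable.add (ContinuousOn.intervalIntegrable (hder'.mul (hu.pow 2))) ?_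
    exact (h.sq.intervalIntegrable p r).continuousOn_mul ha
  rw [add_sub_assoc, ← key, ← intervalIntegral.integral_add hsq h_int]
  refine integral_congr fun x _ => ?_
  ring

/-- A weighted Hardy inequality on a bounded interval. -/
lemma HasDensity.hardy (h : HasDensity u g) (hpr : p ≤ r)
    (hg : IntervalIntegrable (fun x => g x ^ 2) volume p r) {ψ ψ' ρ : ℝ → ℝ} {s k : ℝ}
    (hs : 0 < s) (ha : ContinuousOn a (Icc p r))
    (hψ : ∀ x ∈ Icc p r, HasDerivAt ψ (ψ' x) x) (hψ' : ContinuousOn ψ' (Icc p r))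
    (hρ : ContinuousOn ρ (Icc p r))
    (hlow : ∀ x ∈ Icc p r, s * ρ x ^ 2 ≤ ψ' x + 2 * ψ x * a x)
    (hup : ∀ x ∈ Icc p r, |ψ x| ≤ k * ρ x) :
    s / 2 * ∫ x in p..r, ρ x ^ 2 * u x ^ 2 ≤
      ψ r * u r ^ 2 - ψ p * u p ^ 2 + 2 * k ^ 2 / s * ∫ x in p..r, (g x - a x * u x) ^ 2 := by
  have key := h.integral_mul_sq hpr hψ hψ'
  have hsq := h.intervalIntegrable_sq_sub hpr hg ha
  have hψc : ContinuousOn ψ (Icc p r) := fun x hx => (hψ x hx).continuousAt.continuousWithinAt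
  have hu := h.continuous.continuousOn (s := uIcc p r)
  have h_int : IntervalIntegrable (fun x => ψ' x * u x ^ 2 + ψ x * (2 * u x * g x)) volume p r := by
    rw [← uIcc_of_le hpr] at hψ' hψc
    refine IntervalIntegrable.add (ContinuousOn.intervalIntegrable (hψ'.mul (hu.pow 2))) ?_
    exact (h.sq.intervalIntegrable p r).continuousOn_mul hψc
  have hρu : IntervalIntegrable (fun x => ρ x ^ 2 * u x ^ 2) volume p r := by
    rw [← uIcc_of_le hpr] at hρ
    exact ContinuousOn.intervalIntegrable ((hρ.pow 2).mul (hu.pow 2))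
  rw [← key, ← intervalIntegral.integral_const_mul, ← intervalIntegral.integral_const_mul,
    ← intervalIntegral.integral_add h_int (hsq.const_mul _)]
  refine integral_mono_on hpr (hρu.const_mul _) (h_int.add (hsq.const_mul _)) fun x hx => ?_
  have h1 := mul_le_mul_of_nonneg_right (hlow x hx) (sq_nonneg (u x))
  set d := g x - a x * u x with hd
  have hg' : g x = d + a x * u x := by rw [hd]; ring
  have h2 : -(2 * (ψ x * u x * d)) ≤ 2 * (k * ρ x) * (|u x| * |d|) := by
    have h3 : |ψ x * u x * d| = |ψ x| * (|u x| * |d|) := by rw [abs_mul, abs_mul, mul_assoc]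
    have h4 := mul_le_mul_of_nonneg_right (hup x hx) (by positivity : 0 ≤ |u x| * |d|)
    have h5 := neg_abs_le (ψ x * u x * d)
    linarith
  have h6 : 2 * (k * ρ x) * (|u x| * |d|) ≤
      s / 2 * (ρ x ^ 2 * u x ^ 2) + 2 * k ^ 2 / s * d ^ 2 := by
    have h7 : 0 ≤ (s * ρ x * |u x| - 2 * k * |d|) ^ 2 / (2 * s) := by positivity
    have h8 : (s * ρ x * |u x| - 2 * k * |d|) ^ 2 / (2 * s) =
        s / 2 * (ρ x ^ 2 * |u x| ^ 2) + 2 * k ^ 2 / s * |d| ^ 2 -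
          2 * (k * ρ x) * (|u x| * |d|) := by
      field_simp
      ring
    rw [h8, sq_abs, sq_abs] at h7
    linarith
  rw [hg']
  nlinarith

end HalfLine

section Split

/-- `w` solves `w'' = -(2/3) Q̃³ w` and is positive on `[0, x₁]`. -/
structure IsInnerSol (x₁ : ℝ) (w w' : ℝ → ℝ) : Prop where
  x_pos : 0 < x₁
  hasDerivAt : ∀ x, HasDerivAt w (w' x) x
  hasDerivAt' : ∀ x, HasDerivAt w' (-(2 / 3 * Qt x ^ 3) * w x) x
  pos : ∀ x ∈ Icc 0 x₁, 0 < w x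

/-- The jump at `x₁` of the logarithmic derivative, from `w` on the left to `H̃` on the right. -/
noncomputable def logDerivJump (x₁ : ℝ) (w w' : ℝ → ℝ) : ℝ :=
  Qt x₁ ^ 2 / 3 / Ht x₁ - w' x₁ / w x₁

/-- The sum of the completed squares relative to `w` on `[0, x₁]` and to `H̃` on `[x₁, R]`. -/
noncomputable def splitEnergy (x₁ : ℝ) (w w' u g : ℝ → ℝ) (R : ℝ) : ℝ :=
  (∫ x in (0:ℝ)..x₁, (g x - w' x / w x * u x) ^ 2) +
    ∫ x in x₁..R, (g x - Qt x ^ 2 / 3 / Ht x * u x) ^ 2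

/-- The moment `∫₀ˣ w σ`. -/
noncomputable def innerMoment (w σ : ℝ → ℝ) (x : ℝ) : ℝ := ∫ t in (0:ℝ)..x, w t * σ t

/-- The moment `∫ₓᴿ H̃ σ`. -/
noncomputable def outerMoment (σ : ℝ → ℝ) (R x : ℝ) : ℝ := ∫ t in x..R, Ht t * σ t

/-- The pairing of `σ` with the function which is proportional to `w` on `[0, x₁]`, proportional
to `H̃` on `[x₁, R]`, and equal to one at `x₁`. -/
noncomputable def splitMoment (x₁ : ℝ) (w σ : ℝ → ℝ) (R : ℝ) : ℝ :=
  innerMoment w σ x₁ / w x₁ + outerMoment σ R x₁ / Ht x₁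

/-- The squared norm of the functional by which `∫₀ᴿ σ u` depends on the completed squares. -/
noncomputable def splitNormSq (x₁ : ℝ) (w σ : ℝ → ℝ) (R : ℝ) : ℝ :=
  (∫ x in (0:ℝ)..x₁, (innerMoment w σ x / w x) ^ 2) +
    ∫ x in x₁..R, (outerMoment σ R x / Ht x) ^ 2

variable {x₁ R : ℝ} {w w' σ u g : ℝ → ℝ}

lemma continuousOn_Ht_logDeriv {s : Set ℝ} (hs : ∀ x ∈ s, 0 < x) :
    ContinuousOn (fun x => Qt x ^ 2 / 3 / Ht x) s :=
  ((continuous_Qt.pow 2).div_const 3).continuousOn.div continuous_Ht.continuousOn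
    fun x hx => (Ht_pos (hs x hx)).ne'

lemma IsInnerSol.continuous (h : IsInnerSol x₁ w w') : Continuous w :=
  continuous_iff_continuousAt.2 fun x => (h.hasDerivAt x).continuousAt

lemma IsInnerSol.continuousOn_logDeriv (h : IsInnerSol x₁ w w') :
    ContinuousOn (fun x => w' x / w x) (Icc 0 x₁) :=
  (continuous_iff_continuousAt.2 fun x => (h.hasDerivAt' x).continuousAt).continuousOn.div
    h.continuous.continuousOn fun x hx => (h.pos x hx).ne'

lemma intervalIntegrable_energy (hu : HasDensity u g)
    (hg : ∀ a b : ℝ, IntervalIntegrable (fun x => g x ^ 2) volume a b) (a b : ℝ) :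
    IntervalIntegrable (fun x => g x ^ 2 - 2 / 3 * Qt x ^ 3 * u x ^ 2) volume a b := by
  have := hu.continuous
  have := continuous_Qt
  exact (hg a b).sub (Continuous.intervalIntegrable (by fun_prop) _ _)

lemma splitEnergy_le (h : IsInnerSol x₁ w w') (hu : HasDensity u g)
    (hg : ∀ a b : ℝ, IntervalIntegrable (fun x => g x ^ 2) volume a b)
    (h0 : w' 0 = 0 ∨ u 0 = 0) (hR : x₁ ≤ R) :
    splitEnergy x₁ w w' u g R ≤ (∫ x in (0:ℝ)..R, (g x ^ 2 - 2 / 3 * Qt x ^ 3 * u x ^ 2)) +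
      logDerivJump x₁ w w' * u x₁ ^ 2 := by
  have hV : Continuous fun x => 2 / 3 * Qt x ^ 3 := by
    have := continuous_Qt
    fun_prop
  have h1 := hu.energy_eq h.x_pos.le (hg _ _) (fun x _ => h.hasDerivAt x)
    (fun x _ => h.hasDerivAt' x) hV.continuousOn h.pos
  have h2 := hu.energy_eq hR (hg _ _) (fun x _ => hasDerivAt_Ht x)
    (fun x _ => hasDerivAt_Ht_deriv x) hV.continuousOn
    (fun x hx => Ht_pos (h.x_pos.trans_le hx.1))
  have h3 := intervalIntegral.integral_add_adjacent_intervals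
    (intervalIntegrable_energy hu hg 0 x₁) (intervalIntegrable_energy hu hg x₁ R)
  have h4 : w' 0 / w 0 * u 0 ^ 2 = 0 := by rcases h0 with h0 | h0 <;> simp [h0]
  have h5 : 0 ≤ Qt R ^ 2 / 3 / Ht R * u R ^ 2 := by
    have := Ht_pos (h.x_pos.trans_le hR)
    positivity
  rw [← h3, h1, h2, h4, splitEnergy, logDerivJump]
  linarith

lemma hasDerivAt_innerMoment (hw : Continuous w) (hσ : Continuous σ) (x : ℝ) :
    HasDerivAt (innerMoment w σ) (w x * σ x) x :=
  integral_hasDerivAt_right ((hw.mul hσ).intervalIntegrable _ _)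
    ((hw.mul hσ).stronglyMeasurableAtFilter _ _) (hw.mul hσ).continuousAt

lemma hasDerivAt_outerMoment (hσ : Continuous σ) (R x : ℝ) :
    HasDerivAt (outerMoment σ R) (-(Ht x * σ x)) x :=
  have hc := continuous_Ht.mul hσ
  integral_hasDerivAt_left (hc.intervalIntegrable _ _)
    (hc.stronglyMeasurableAtFilter _ _) hc.continuousAt

lemma continuous_innerMoment (hw : Continuous w) (hσ : Continuous σ) :
    Continuous (innerMoment w σ) :=
  continuous_iff_continuousAt.2 fun x => (hasDerivAt_innerMoment hw hσ x).continuousAt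

lemma continuous_outerMoment (hσ : Continuous σ) (R : ℝ) : Continuous (outerMoment σ R) :=
  continuous_iff_continuousAt.2 fun x => (hasDerivAt_outerMoment hσ R x).continuousAt

lemma HasDensity.two_mul_integral_le (hu : HasDensity u g) {p r : ℝ} (hpr : p ≤ r)
    (hg : IntervalIntegrable (fun x => g x ^ 2) volume p r) {c a : ℝ → ℝ}
    (ha : ContinuousOn a (Icc p r)) (hσ : Continuous σ)
    (hc : ∀ x ∈ Icc p r, HasDerivAt c (σ x - a x * c x) x) (l : ℝ) :
    2 * l * (c r * u r - c p * u p - ∫ x in p..r, σ x * u x) ≤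
      l ^ 2 * (∫ x in p..r, c x ^ 2) + ∫ x in p..r, (g x - a x * u x) ^ 2 := by
  have hcc : ContinuousOn c (Icc p r) := fun x hx => (hc x hx).continuousAt.continuousWithinAt
  have hcont := hu.continuous
  have key := hu.integral_mul hpr hc (hσ.continuousOn.sub (ha.mul hcc))
  have hsq := hu.intervalIntegrable_sq_sub hpr hg ha
  have hac := ha
  rw [← uIcc_of_le hpr] at hac hcc
  have i1 : IntervalIntegrable (fun x => (σ x - a x * c x) * u x + c x * g x) volume p r := by
    refine IntervalIntegrable.add (ContinuousOn.intervalIntegrable (by fun_prop)) ?_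
    exact (hu.intervalIntegrable p r).continuousOn_mul hcc
  have i2 : IntervalIntegrable (fun x => σ x * u x) volume p r :=
    (hσ.mul hcont).intervalIntegrable _ _
  have i3 : IntervalIntegrable (fun x => c x ^ 2) volume p r :=
    ContinuousOn.intervalIntegrable (by fun_prop)
  rw [← key, ← intervalIntegral.integral_sub i1 i2, ← intervalIntegral.integral_const_mul,
    ← intervalIntegral.integral_const_mul, ← intervalIntegral.integral_add (i3.const_mul _) hsq]
  refine integral_mono_on hpr ((i1.sub i2).const_mul _) ((i3.const_mul _).add hsq) fun x _ => ?_
  nlinarith [sq_nonneg (l * c x - (g x - a x * u x))]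

lemma two_mul_splitMoment_le (h : IsInnerSol x₁ w w') (hu : HasDensity u g)
    (hg : ∀ a b : ℝ, IntervalIntegrable (fun x => g x ^ 2) volume a b) (hσ : Continuous σ)
    (hR : x₁ ≤ R) (l : ℝ) :
    2 * l * (splitMoment x₁ w σ R * u x₁ - ∫ x in (0:ℝ)..R, σ x * u x) ≤
      l ^ 2 * splitNormSq x₁ w σ R + splitEnergy x₁ w w' u g R := by
  have hcont := hu.continuous
  have hpos : ∀ x ∈ Icc x₁ R, 0 < x := fun x hx => h.x_pos.trans_le hx.1
  have h1 := hu.two_mul_integral_le (σ := σ) h.x_pos.le (hg _ _) h.continuousOn_logDeriv hσ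
    (c := fun x => innerMoment w σ x / w x) (fun x hx => by
      have hne := (h.pos x hx).ne'
      refine ((hasDerivAt_innerMoment h.continuous hσ x).div (h.hasDerivAt x) hne).congr_deriv ?_
      field_simp) l
  have h2 := hu.two_mul_integral_le (σ := σ) hR (hg _ _) (continuousOn_Ht_logDeriv hpos) hσ
    (c := fun x => -(outerMoment σ R x / Ht x)) (fun x hx => by
      have hne := (Ht_pos (hpos x hx)).ne'
      refine ((hasDerivAt_outerMoment hσ R x).div (hasDerivAt_Ht x) hne).neg.congr_deriv ?_
      field_simp
      ring) l
  have h3 := intervalIntegral.integral_add_adjacent_intervals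
    ((hσ.mul hcont).intervalIntegrable (μ := volume) 0 x₁)
    ((hσ.mul hcont).intervalIntegrable x₁ R)
  simp only [Pi.mul_apply] at h3
  have h4 : innerMoment w σ 0 = 0 := by simp [innerMoment]
  have h5 : outerMoment σ R R = 0 := by simp [outerMoment]
  simp only [h4, h5, zero_div, neg_zero, zero_mul, neg_sq, neg_mul, sub_zero] at h1 h2
  rw [← h3, splitMoment, splitNormSq, splitEnergy]
  linarith

end Split

section HalfLine

variable {x₁ R : ℝ} {w w' σ u g : ℝ → ℝ}

lemma exists_inner_hardy (h : IsInnerSol x₁ w w') : ∃ K, 0 ≤ K ∧ ∀ u g : ℝ → ℝ, HasDensity u g →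
    IntervalIntegrable (fun x => g x ^ 2) volume 0 x₁ →
    ∫ x in (0:ℝ)..x₁, Qt x ^ 2 * u x ^ 2 ≤
      K * (u x₁ ^ 2 + ∫ x in (0:ℝ)..x₁, (g x - w' x / w x * u x) ^ 2) := by
  have hw := h.continuous
  have hw' : Continuous w' := continuous_iff_continuousAt.2 fun x => (h.hasDerivAt' x).continuousAt
  have hQ := continuous_Qt
  have hne : ∀ x ∈ Icc 0 x₁, w x ≠ 0 := fun x hx => (h.pos x hx).ne'
  have hρ : ContinuousOn (fun x => 1 / w x) (Icc 0 x₁) :=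
    continuousOn_const.div hw.continuousOn hne
  obtain ⟨k, hk⟩ := isCompact_Icc.exists_bound_of_continuousOn
    (continuousOn_id.div hw.continuousOn hne)
  obtain ⟨M, hM⟩ := (isCompact_Icc (a := (0:ℝ)) (b := x₁)).exists_bound_of_continuousOn
    (f := fun x => Qt x * w x) (by fun_prop)
  have hx₁ : 0 ≤ x₁ / w x₁ ^ 2 := div_nonneg h.x_pos.le (sq_nonneg _)
  refine ⟨2 * M ^ 2 * (x₁ / w x₁ ^ 2 + 2 * k ^ 2), by positivity, fun u g hu hg => ?_⟩
  have hcont := hu.continuous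
  have hardy := hu.hardy (ψ := fun x => x / w x ^ 2) (k := k) h.x_pos.le hg one_pos
    h.continuousOn_logDeriv (fun x hx => (hasDerivAt_id x).div ((h.hasDerivAt x).pow 2)
      (pow_ne_zero 2 (hne x hx)))
    (ContinuousOn.div (by fun_prop) (by fun_prop)
      fun x hx => pow_ne_zero 2 (pow_ne_zero 2 (hne x hx))) hρ
    (fun x hx => by
      have := hne x hx
      simp only [id, one_mul, Pi.pow_apply, Pi.div_apply]
      refine le_of_eq ?_
      field_simp
      ring)
    (fun x hx => by
      have h1 := hk x hx
      have h2 := h.pos x hx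
      have h3 : x / w x ^ 2 = x / w x * (1 / w x) := by field_simp
      rw [h3, abs_mul, abs_of_pos (one_div_pos.2 h2)]
      exact mul_le_mul_of_nonneg_right h1 (one_div_pos.2 h2).le)
  have hD : 0 ≤ ∫ x in (0:ℝ)..x₁, (g x - w' x / w x * u x) ^ 2 :=
    integral_nonneg h.x_pos.le fun x _ => sq_nonneg _
  have hmono : ∫ x in (0:ℝ)..x₁, Qt x ^ 2 * u x ^ 2 ≤
      ∫ x in (0:ℝ)..x₁, M ^ 2 * ((1 / w x) ^ 2 * u x ^ 2) := by
    rw [← uIcc_of_le h.x_pos.le] at hρ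
    refine integral_mono_on h.x_pos.le (Continuous.intervalIntegrable (by fun_prop) _ _)
      (ContinuousOn.intervalIntegrable (by fun_prop)) fun x hx => ?_
    have h1 : (Qt x * w x) ^ 2 ≤ M ^ 2 := sq_le_sq' (neg_le_of_abs_le (hM x hx))
      (le_of_abs_le (hM x hx))
    have h2 : Qt x ^ 2 = (Qt x * w x) ^ 2 * (1 / w x) ^ 2 := by
      have := hne x hx
      field_simp
    rw [h2, mul_assoc]
    exact mul_le_mul_of_nonneg_right h1 (by positivity)
  rw [intervalIntegral.integral_const_mul] at hmono
  simp only [zero_div, zero_mul, sub_zero, div_one] at hardy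
  set I := ∫ x in (0:ℝ)..x₁, (1 / w x) ^ 2 * u x ^ 2
  set D := ∫ x in (0:ℝ)..x₁, (g x - w' x / w x * u x) ^ 2
  have h5 : I ≤ 2 * (x₁ / w x₁ ^ 2 + 2 * k ^ 2) * (u x₁ ^ 2 + D) := by
    nlinarith [mul_nonneg hx₁ hD, mul_nonneg (sq_nonneg k) (sq_nonneg (u x₁))]
  calc _ ≤ _ := hmono
    _ ≤ M ^ 2 * (2 * (x₁ / w x₁ ^ 2 + 2 * k ^ 2) * (u x₁ ^ 2 + D)) :=
      mul_le_mul_of_nonneg_left h5 (sq_nonneg M)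
    _ = _ := by ring

lemma exists_outer_hardy (hx₁ : 0 < x₁) : ∃ K, 0 ≤ K ∧ ∀ u g : ℝ → ℝ, HasDensity u g →
    ∀ R, x₁ ≤ R → IntervalIntegrable (fun x => g x ^ 2) volume x₁ R →
    ∫ x in x₁..R, Qt x ^ 2 * u x ^ 2 ≤
      K * (u x₁ ^ 2 + ∫ x in x₁..R, (g x - Qt x ^ 2 / 3 / Ht x * u x) ^ 2) := by
  have hH1 := Ht_pos hx₁
  have hc : 0 ≤ (1 - Ht x₁) / Ht x₁ ^ 2 :=
    div_nonneg (by linarith [Ht_lt_one x₁]) (sq_nonneg _)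
  set k := 2 / 3 / Ht x₁ ^ 2
  refine ⟨6 * ((1 - Ht x₁) / Ht x₁ ^ 2) + 36 * k ^ 2, by positivity, fun u g hu R hR hg => ?_⟩
  have hpos : ∀ x ∈ Icc x₁ R, 0 < x := fun x hx => hx₁.trans_le hx.1
  have hne : ∀ x ∈ Icc x₁ R, Ht x ≠ 0 := fun x hx => (Ht_pos (hpos x hx)).ne'
  have hQ := continuous_Qt
  have hHc := continuous_Ht
  have hardy := hu.hardy (ψ := fun x => (Ht x - 1) / Ht x ^ 2) (ρ := Qt) (k := k) hR hg
    (show (0:ℝ) < 1 / 3 by norm_num)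
    (continuousOn_Ht_logDeriv hpos)
    (fun x hx => ((hasDerivAt_Ht x).sub_const 1).div ((hasDerivAt_Ht x).pow 2)
      (pow_ne_zero 2 (hne x hx)))
    (ContinuousOn.div (by fun_prop) (by fun_prop)
      fun x hx => pow_ne_zero 2 (pow_ne_zero 2 (hne x hx))) hQ.continuousOn
    (fun x hx => by
      have h1 := Ht_pos (hpos x hx)
      have h2 := Ht_lt_one x
      have h3 : 1 / 3 * Qt x ^ 2 ≤ Qt x ^ 2 / 3 / Ht x ^ 2 := by
        rw [le_div_iff₀ (by positivity)]
        nlinarith [sq_nonneg (Qt x), mul_nonneg (sq_nonneg (Qt x)) (Qt_pos x).le, Ht_sq x]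
      refine h3.trans (le_of_eq ?_)
      simp only [Pi.pow_apply, Pi.div_apply]
      field_simp
      ring)
    (fun x hx => by
      have h1 := Ht_pos (hpos x hx)
      have h2 := Ht_lt_one x
      have h4 := strictMono_Ht.monotone hx.1
      rw [abs_div, abs_of_nonpos (by linarith), abs_of_pos (by positivity)]
      calc -(Ht x - 1) / Ht x ^ 2 ≤ (2 / 3 * Qt x) / Ht x₁ ^ 2 := by
            have := Qt_pos x
            have := one_sub_Ht_le (hpos x hx).le
            gcongr
            linarith
        _ = k * Qt x := by ring)
  have hD : 0 ≤ ∫ x in x₁..R, (g x - Qt x ^ 2 / 3 / Ht x * u x) ^ 2 :=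
    integral_nonneg hR fun x _ => sq_nonneg _
  have hψR : (Ht R - 1) / Ht R ^ 2 * u R ^ 2 ≤ 0 :=
    mul_nonpos_of_nonpos_of_nonneg
      (div_nonpos_of_nonpos_of_nonneg (by linarith [Ht_lt_one R]) (sq_nonneg _)) (sq_nonneg _)
  have hψ₁ : (Ht x₁ - 1) / Ht x₁ ^ 2 * u x₁ ^ 2 = -((1 - Ht x₁) / Ht x₁ ^ 2 * u x₁ ^ 2) := by ring
  set D := ∫ x in x₁..R, (g x - Qt x ^ 2 / 3 / Ht x * u x) ^ 2
  nlinarith [mul_nonneg hc hD, mul_nonneg (sq_nonneg k) (sq_nonneg (u x₁))]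

lemma IsInnerSol.exists_hardy (h : IsInnerSol x₁ w w') : ∃ K, 0 < K ∧ ∀ u g : ℝ → ℝ,
    HasDensity u g → (∀ a b : ℝ, IntervalIntegrable (fun x => g x ^ 2) volume a b) →
    ∀ R, x₁ ≤ R →
    ∫ x in (0:ℝ)..R, Qt x ^ 2 * u x ^ 2 ≤ K * (u x₁ ^ 2 + splitEnergy x₁ w w' u g R) := by
  obtain ⟨K₁, h₁, hK₁⟩ := exists_inner_hardy h
  obtain ⟨K₂, h₂, hK₂⟩ := exists_outer_hardy h.x_pos
  refine ⟨K₁ + K₂ + 1, by positivity, fun u g hu hg R hR => ?_⟩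
  have hc : Continuous fun x => Qt x ^ 2 * u x ^ 2 := by
    have := hu.continuous
    have := continuous_Qt
    fun_prop
  rw [← intervalIntegral.integral_add_adjacent_intervals (hc.intervalIntegrable 0 x₁)
    (hc.intervalIntegrable x₁ R), splitEnergy]
  have i₁ := hK₁ u g hu (hg _ _)
  have i₂ := hK₂ u g hu R hR (hg _ _)
  have d₁ : 0 ≤ ∫ x in (0:ℝ)..x₁, (g x - w' x / w x * u x) ^ 2 :=
    integral_nonneg h.x_pos.le fun x _ => sq_nonneg _
  have d₂ : 0 ≤ ∫ x in x₁..R, (g x - Qt x ^ 2 / 3 / Ht x * u x) ^ 2 :=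
    integral_nonneg hR fun x _ => sq_nonneg _
  nlinarith [mul_nonneg h₁ d₂, mul_nonneg h₂ d₁, sq_nonneg (u x₁)]

/-- On each bounded interval `u x₁` is controlled by the energy and the moment of `u`. -/
lemma IsInnerSol.sq_le (h : IsInnerSol x₁ w w') (hu : HasDensity u g)
    (hg : ∀ a b : ℝ, IntervalIntegrable (fun x => g x ^ 2) volume a b) (hσ : Continuous σ)
    (h0 : w' 0 = 0 ∨ u 0 = 0) (hR : x₁ ≤ R) {κ θ : ℝ} (hκ : 0 < κ)
    (hβ : 0 < logDerivJump x₁ w w') (hκR : κ ≤ splitMoment x₁ w σ R)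
    (hN : logDerivJump x₁ w w' * splitNormSq x₁ w σ R ≤ θ * splitMoment x₁ w σ R ^ 2) :
    logDerivJump x₁ w w' * (1 - θ) * u x₁ ^ 2 ≤
      (∫ x in (0:ℝ)..R, (g x ^ 2 - 2 / 3 * Qt x ^ 3 * u x ^ 2)) +
        2 * logDerivJump x₁ w w' / κ * |u x₁| * |∫ x in (0:ℝ)..R, σ x * u x| := by
  have h1 := splitEnergy_le h hu hg h0 hR
  set β := logDerivJump x₁ w w'
  set m := splitMoment x₁ w σ R
  have hm : 0 < m := hκ.trans_le hκR
  have h2 := two_mul_splitMoment_le h hu hg hσ hR (β * u x₁ / m)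
  set N := splitNormSq x₁ w σ R
  set e := ∫ x in (0:ℝ)..R, σ x * u x
  have h3 : (β * u x₁ / m) ^ 2 * N ≤ β * θ * u x₁ ^ 2 := by
    have : (β * u x₁ / m) ^ 2 * N = β * u x₁ ^ 2 / m ^ 2 * (β * N) := by field_simp
    rw [this]
    calc _ ≤ β * u x₁ ^ 2 / m ^ 2 * (θ * m ^ 2) := by gcongr
      _ = _ := by field_simp
  have h4 : 2 * (β * u x₁ / m) * (m * u x₁ - e) =
      2 * β * u x₁ ^ 2 - 2 * β / m * (u x₁ * e) := by field_simp
  have h5 : 2 * β / m * (u x₁ * e) ≤ 2 * β / κ * |u x₁| * |e| := by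
    rw [mul_assoc, ← abs_mul]
    calc _ ≤ 2 * β / m * |u x₁ * e| := by gcongr; exact le_abs_self _
      _ ≤ _ := by gcongr
  linarith

/-- Coercivity on the half line for functions with vanishing `σ`-moment. -/
lemma IsInnerSol.exists_coercive (h : IsInnerSol x₁ w w') (hσ : Continuous σ) {κ θ R₀ : ℝ}
    (hκ : 0 < κ) (hθ : θ < 1) (hβ : 0 < logDerivJump x₁ w w')
    (hκR : ∀ R, R₀ ≤ R → κ ≤ splitMoment x₁ w σ R)
    (hN : ∀ R, R₀ ≤ R →
      logDerivJump x₁ w w' * splitNormSq x₁ w σ R ≤ θ * splitMoment x₁ w σ R ^ 2) :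
    ∃ C, 0 < C ∧ ∀ u g : ℝ → ℝ, HasDensity u g → Integrable (fun x => g x ^ 2) →
      Integrable (fun x => Qt x ^ 2 * u x ^ 2) → Integrable (fun x => Qt x ^ 3 * u x ^ 2) →
      Integrable (fun x => σ x * u x) → ∫ x in Ioi 0, σ x * u x = 0 → (w' 0 = 0 ∨ u 0 = 0) →
      ∫ x in Ioi 0, Qt x ^ 2 * u x ^ 2 ≤
        C * ∫ x in Ioi 0, (g x ^ 2 - 2 / 3 * Qt x ^ 3 * u x ^ 2) := by
  obtain ⟨K, hK0, hK⟩ := h.exists_hardy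
  set β := logDerivJump x₁ w w'
  have hβθ : 0 < β * (1 - θ) := mul_pos hβ (sub_pos.2 hθ)
  refine ⟨K * ((1 + β) * (1 / (β * (1 - θ))) + 1), by positivity,
    fun u g hu hg hQ2 hQ3 hσu hmom h0 => ?_⟩
  have hgi : ∀ a b : ℝ, IntervalIntegrable (fun x => g x ^ 2) volume a b :=
    fun a b => hg.intervalIntegrable
  have hE : Integrable fun x => g x ^ 2 - 2 / 3 * Qt x ^ 3 * u x ^ 2 := by
    refine (hg.sub (hQ3.const_mul (2 / 3))).congr (ae_of_all _ fun x => ?_)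
    simp [mul_assoc]
  have limE := intervalIntegral_tendsto_integral_Ioi 0 hE.integrableOn tendsto_id
  have limQ := intervalIntegral_tendsto_integral_Ioi 0 hQ2.integrableOn tendsto_id
  have limσ := intervalIntegral_tendsto_integral_Ioi 0 hσu.integrableOn tendsto_id
  rw [hmom] at limσ
  simp only [id] at limE limQ limσ
  set B := ∫ x in Ioi 0, (g x ^ 2 - 2 / 3 * Qt x ^ 3 * u x ^ 2)
  have hpt : β * (1 - θ) * u x₁ ^ 2 ≤ B := by
    have lim := limE.add (limσ.abs.const_mul (2 * β / κ * |u x₁|))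
    rw [abs_zero, mul_zero, add_zero] at lim
    refine ge_of_tendsto lim ?_
    filter_upwards [eventually_ge_atTop R₀, eventually_ge_atTop x₁] with R hR hR₁
    exact h.sq_le hu hgi hσ h0 hR₁ hκ hβ (hκR R hR) (hN R hR)
  have hpt' : u x₁ ^ 2 ≤ 1 / (β * (1 - θ)) * B := by
    rw [one_div, inv_mul_eq_div, le_div_iff₀ hβθ]
    linarith
  have hlim : ∫ x in Ioi 0, Qt x ^ 2 * u x ^ 2 ≤ K * (u x₁ ^ 2 + (B + β * u x₁ ^ 2)) := by
    refine le_of_tendsto_of_tendsto limQ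
      (((limE.add_const (β * u x₁ ^ 2)).const_add (u x₁ ^ 2)).const_mul K) ?_
    filter_upwards [eventually_ge_atTop x₁] with R hR
    refine (hK u g hu hgi R hR).trans ?_
    have := splitEnergy_le h hu hgi h0 hR
    gcongr
  calc _ ≤ _ := hlim
    _ = K * ((1 + β) * u x₁ ^ 2 + B) := by ring
    _ ≤ K * ((1 + β) * (1 / (β * (1 - θ)) * B) + B) := by gcongr
    _ = _ := by ring

end HalfLine

section Even

/-- The even ground state of `-∂² + V`, with eigenvalue `-μ²`. -/
structure IsGroundState (μ : ℝ) (φ φ' : ℝ → ℝ) : Prop where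
  le_mu : 0.808 ≤ μ
  hasDerivAt : ∀ x, HasDerivAt φ (φ' x) x
  hasDerivAt' : ∀ x, HasDerivAt φ' ((Vpot x + μ ^ 2) * φ x) x
  pos : ∀ x, 0 < φ x
  deriv_zero : φ' 0 = 0
  deriv_nonpos : ∀ x, 0 ≤ x → φ' x ≤ 0

lemma antitoneOn_Qt : AntitoneOn Qt (Ici 0) := by
  refine antitoneOn_of_deriv_nonpos (convex_Ici 0) continuous_Qt.continuousOn
    (fun x _ => (hasDerivAt_Qt x).differentiableAt.differentiableWithinAt) fun x hx => ?_
  rw [(hasDerivAt_Qt x).deriv]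
  rw [interior_Ici] at hx
  have := Ht_pos hx
  have := Qt_pos x
  exact neg_nonpos.2 (by positivity)

/-- The potential `V + μ²` changes sign at most once on the half line. -/
lemma Vpot_add_sq_nonneg {μ x y : ℝ} (hx : 0 ≤ x) (hxy : x ≤ y) (h : 0 ≤ Vpot x + μ ^ 2) :
    0 ≤ Vpot y + μ ^ 2 := by
  have h1 := antitoneOn_Qt hx (hx.trans hxy) hxy
  have h2 := Qt_pos y
  unfold Vpot at *
  rcases le_or_gt (Qt y) 1 with h3 | h3
  · have := sub_nonneg.2 h3
    positivity
  · have h4 : Qt y ^ 2 * (Qt y - 1) ≤ Qt x ^ 2 * (Qt x - 1) := by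
      have := sub_pos.2 h3
      gcongr
    linarith

lemma deriv_nonpos_of_tendsto {μ : ℝ} {φ φ' : ℝ → ℝ}
    (hφ' : ∀ x, HasDerivAt φ' ((Vpot x + μ ^ 2) * φ x) x) (hpos : ∀ x, 0 < φ x)
    (h0 : φ' 0 = 0) (hlim : Tendsto φ' atTop (𝓝 0)) {x : ℝ} (hx : 0 ≤ x) : φ' x ≤ 0 := by
  have hc : Continuous φ' := continuous_iff_continuousAt.2 fun x => (hφ' x).continuousAt
  rcases le_or_gt 0 (Vpot x + μ ^ 2) with h | h
  · have hm : MonotoneOn φ' (Ici x) := by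
      refine monotoneOn_of_deriv_nonneg (convex_Ici x) hc.continuousOn
        (fun y _ => (hφ' y).differentiableAt.differentiableWithinAt) fun y hy => ?_
      rw [(hφ' y).deriv]
      rw [interior_Ici] at hy
      exact mul_nonneg (Vpot_add_sq_nonneg hx (le_of_lt hy) h) (hpos y).le
    refine ge_of_tendsto hlim ?_
    filter_upwards [eventually_ge_atTop x] with y hy
    exact hm self_mem_Ici hy hy
  · have hm : AntitoneOn φ' (Icc 0 x) := by
      refine antitoneOn_of_deriv_nonpos (convex_Icc 0 x) hc.continuousOn
        (fun y _ => (hφ' y).differentiableAt.differentiableWithinAt) fun y hy => ?_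
      rw [(hφ' y).deriv]
      rw [interior_Icc] at hy
      refine mul_nonpos_of_nonpos_of_nonneg ?_ (hpos y).le
      by_contra! hn
      exact h.not_ge (Vpot_add_sq_nonneg hy.1.le hy.2.le hn.le)
    rw [← h0]
    exact hm (left_mem_Icc.2 hx) (right_mem_Icc.2 hx) hx

lemma le_of_Ht {x : ℝ} (hx : 0 ≤ x) : 4 / 3 * Ht x + 8 / 9 * Ht x ^ 3 ≤ x := by
  have hd : ∀ y, HasDerivAt (fun x => x - (4 / 3 * Ht x + 8 / 9 * Ht x ^ 3))
      (1 - (4 / 3 * (Qt y ^ 2 / 3) + 8 / 9 * (3 * Ht y ^ 2 * (Qt y ^ 2 / 3)))) y := fun y => by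
    refine ((hasDerivAt_id y).sub (((hasDerivAt_Ht y).const_mul (4 / 3)).add
      (((hasDerivAt_Ht y).pow 3).const_mul (8 / 9)))).congr_deriv ?_
    norm_num
  have hm : Monotone fun x => x - (4 / 3 * Ht x + 8 / 9 * Ht x ^ 3) := by
    refine monotone_of_deriv_nonneg (fun y => (hd y).differentiableAt) fun y => ?_
    rw [(hd y).deriv]
    have hQ : Qt y = 3 / 2 * (1 - Ht y ^ 2) := by linarith [Ht_sq y]
    have h1 : Ht y ^ 2 ≤ 1 := by linarith [Ht_sq y, Qt_pos y]
    rw [hQ]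
    set s := Ht y ^ 2
    have hs : 0 ≤ s := sq_nonneg _
    nlinarith [mul_nonneg (sq_nonneg s) (sub_nonneg.2 h1), mul_nonneg hs hs]
  simpa [Ht_zero] using hm hx

variable {μ x₁ X R : ℝ} {φ φ' : ℝ → ℝ}

/-- The primitive of `2 Q̃² H̃² / μ²` which vanishes at the origin. -/
noncomputable def cubeMoment (μ x : ℝ) : ℝ := 2 * Ht x ^ 3 / μ ^ 2

lemma hasDerivAt_cubeMoment (μ x : ℝ) :
    HasDerivAt (cubeMoment μ) (2 * Qt x ^ 2 * Ht x ^ 2 / μ ^ 2) x := by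
  refine ((((hasDerivAt_Ht x).pow 3).const_mul 2).div_const (μ ^ 2)).congr_deriv ?_
  norm_num
  ring

lemma cubeMoment_le (hμ : 0.808 ≤ μ) {x : ℝ} (hx : 0 ≤ x) (hH : Ht x ≤ 2 / 3) :
    cubeMoment μ x ≤ x := by
  have hμ2 : 0.65 ≤ μ ^ 2 := by nlinarith
  refine le_trans ?_ (le_of_Ht hx)
  have h0 := Ht_nonneg hx
  rw [cubeMoment, div_le_iff₀ (by positivity)]
  have h2 : Ht x ^ 2 ≤ 4 / 9 := by nlinarith
  have h3 : 0 ≤ Ht x * (4 / 9 - Ht x ^ 2) := mul_nonneg h0 (by linarith)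
  have h4 : 0 ≤ 4 / 3 * Ht x + 8 / 9 * Ht x ^ 3 := by positivity
  nlinarith [mul_le_mul_of_nonneg_left hμ2 h4]

lemma cubeMoment_lt (hμ : 0.808 ≤ μ) (hX : 0 < X) (hH : Ht X ≤ 2 / 3) (h2 : 2 ≤ 3 * X * Ht X) :
    cubeMoment μ X < X := by
  have hμ2 : 0.65 ≤ μ ^ 2 := by nlinarith
  have h0 := Ht_pos hX
  rw [cubeMoment, div_lt_iff₀ (by positivity)]
  have h3 : Ht X ^ 2 ≤ 4 / 9 := by nlinarith
  have h4 : Ht X ^ 4 ≤ 16 / 81 := by nlinarith [sq_nonneg (Ht X)]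
  have h5 : 2 * 0.65 ≤ 3 * X * Ht X * μ ^ 2 := by gcongr
  have h6 : 3 * Ht X * (2 * Ht X ^ 3) < 3 * Ht X * (X * μ ^ 2) := by nlinarith
  exact lt_of_mul_lt_mul_left h6 (by positivity)

namespace IsGroundState

lemma continuous (h : IsGroundState μ φ φ') : Continuous φ :=
  continuous_iff_continuousAt.2 fun x => (h.hasDerivAt x).continuousAt

lemma continuous_deriv (h : IsGroundState μ φ φ') : Continuous φ' :=
  continuous_iff_continuousAt.2 fun x => (h.hasDerivAt' x).continuousAt

/-- Green's identity for `φ` and the even solution. -/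
lemma green (h : IsGroundState μ φ φ') (R : ℝ) :
    ∫ x in (0:ℝ)..R, (μ ^ 2 + 2 * Qt x ^ 2 * Ht x ^ 2) * (evenSol x * φ x) =
      φ' R * evenSol R - φ R * evenSolDeriv R := by
  have hc := h.continuous
  have := continuous_Qt
  have := continuous_Ht
  have := continuous_evenSol
  rw [integral_eq_sub_of_hasDerivAt
    (f := fun x => φ' x * evenSol x - φ x * evenSolDeriv x) (fun x _ => ?_)
    (Continuous.intervalIntegrable (by fun_prop) _ _)]
  · simp [h.deriv_zero, evenSolDeriv_zero]
  · refine (((h.hasDerivAt' x).mul (hasDerivAt_evenSol x)).sub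
      ((h.hasDerivAt x).mul (hasDerivAt_evenSolDeriv x))).congr_deriv ?_
    rw [Ht_sq, Vpot]
    ring

lemma neg_integral_le (h : IsGroundState μ φ φ') (hX : 0 < X) (hfX : evenSol X = 0)
    (hR : X ≤ R) :
    -(∫ x in (0:ℝ)..X, 2 * Qt x ^ 2 * Ht x ^ 2 / μ ^ 2 * (evenSol x * φ x)) ≤
      ∫ x in (0:ℝ)..R, evenSol x * φ x := by
  have hc := h.continuous
  have := continuous_Qt
  have := continuous_Ht
  have := continuous_evenSol
  have hμ : 0 < μ := by linarith [h.le_mu]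
  have hf : ∀ x, X ≤ x → evenSol x ≤ 0 := fun x hx => by
    rw [← hfX]
    exact strictAntiOn_evenSol.antitoneOn hX.le (hX.le.trans hx) hx
  have hgreen := h.green R
  have hW : 0 ≤ φ' R * evenSol R - φ R * evenSolDeriv R := by
    have hR0 := hX.trans_le hR
    have := mul_nonneg_of_nonpos_of_nonpos (h.deriv_nonpos R hR0.le) (hf R hR)
    have := mul_nonpos_of_nonneg_of_nonpos (h.pos R).le (evenSolDeriv_neg hR0).le
    linarith
  have i1 : Continuous fun x => 2 * Qt x ^ 2 * Ht x ^ 2 / μ ^ 2 * (evenSol x * φ x) := by fun_prop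
  have i2 : Continuous fun x => evenSol x * φ x := by fun_prop
  have hsplit : ∫ x in (0:ℝ)..R, (μ ^ 2 + 2 * Qt x ^ 2 * Ht x ^ 2) * (evenSol x * φ x) =
      μ ^ 2 * ((∫ x in (0:ℝ)..R, evenSol x * φ x) +
        ((∫ x in (0:ℝ)..X, 2 * Qt x ^ 2 * Ht x ^ 2 / μ ^ 2 * (evenSol x * φ x)) +
        ∫ x in X..R, 2 * Qt x ^ 2 * Ht x ^ 2 / μ ^ 2 * (evenSol x * φ x))) := by
    rw [intervalIntegral.integral_add_adjacent_intervals (i1.intervalIntegrable _ _)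
      (i1.intervalIntegrable _ _), ← intervalIntegral.integral_add (i2.intervalIntegrable _ _)
      (i1.intervalIntegrable _ _), ← intervalIntegral.integral_const_mul]
    congr 1
    ext x
    field_simp
  have hneg : ∫ x in X..R, 2 * Qt x ^ 2 * Ht x ^ 2 / μ ^ 2 * (evenSol x * φ x) ≤ 0 := by
    have := integral_mono_on hR (i1.intervalIntegrable (μ := volume) X R)
      (intervalIntegrable_const (c := (0:ℝ))) fun x hx =>
      mul_nonpos_of_nonneg_of_nonpos (by positivity)
        (mul_nonpos_of_nonpos_of_nonneg (hf x hx.1) (h.pos x).le)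
    simpa using this
  rw [hsplit] at hgreen
  have := nonneg_of_mul_nonneg_right (hgreen ▸ hW) (by positivity)
  linarith

lemma mul_antitoneOn (h : IsGroundState μ φ φ') (hX : 0 < X) (hfX : evenSol X = 0) {x : ℝ}
    (hx : x ∈ Icc 0 X) : evenSolDeriv x * φ x + evenSol x * φ' x ≤ 0 := by
  have h1 : 0 ≤ evenSol x := by
    rw [← hfX]
    exact strictAntiOn_evenSol.antitoneOn hx.1 hX.le hx.2
  have h2 : evenSolDeriv x ≤ 0 := by
    rcases hx.1.eq_or_lt with h0 | h0
    · rw [← h0, evenSolDeriv_zero]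
    · exact (evenSolDeriv_neg h0).le
  have := mul_nonpos_of_nonpos_of_nonneg h2 (h.pos x).le
  have := mul_nonpos_of_nonneg_of_nonpos h1 (h.deriv_nonpos x hx.1)
  linarith

lemma le_integral_add (h : IsGroundState μ φ φ') (hX : 0 < X) (hfX : evenSol X = 0)
    (hH : Ht X ≤ 2 / 3) (hx₁ : 0 < x₁) (hx₁X : x₁ ≤ X) (hR : X ≤ R) :
    evenSol x₁ * φ x₁ * (x₁ - cubeMoment μ X) ≤
      (∫ x in (0:ℝ)..x₁, evenSol x * φ x) + ∫ x in (0:ℝ)..R, evenSol x * φ x := by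
  have hc := h.continuous
  have := h.continuous_deriv
  have := continuous_Qt
  have := continuous_Ht
  have := continuous_evenSol
  have := continuous_evenSolDeriv
  have hμ : 0 < μ := by linarith [h.le_mu]
  have hn : Continuous (cubeMoment μ) :=
    continuous_iff_continuousAt.2 fun x => (hasDerivAt_cubeMoment μ x).continuousAt
  have hprod : ∀ x, HasDerivAt (fun x => evenSol x * φ x)
      (evenSolDeriv x * φ x + evenSol x * φ' x) x :=
    fun x => (hasDerivAt_evenSol x).mul (h.hasDerivAt x)
  have hanti : AntitoneOn (fun x => evenSol x * φ x) (Icc 0 X) := by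
    refine antitoneOn_of_deriv_nonpos (convex_Icc 0 X) (by fun_prop)
      (fun x _ => (hprod x).differentiableAt.differentiableWithinAt) fun x hx => ?_
    rw [(hprod x).deriv]
    exact h.mul_antitoneOn hX hfX (interior_subset hx)
  have i1 : Continuous fun x => 2 * Qt x ^ 2 * Ht x ^ 2 / μ ^ 2 * (evenSol x * φ x) := by fun_prop
  have i2 : Continuous fun x => evenSol x * φ x := by fun_prop
  have hgreen := h.neg_integral_le hX hfX hR
  rw [← intervalIntegral.integral_add_adjacent_intervals (i1.intervalIntegrable 0 x₁)
    (i1.intervalIntegrable x₁ X)] at hgreen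
  have hin : evenSol x₁ * φ x₁ * (x₁ - cubeMoment μ x₁) ≤ (∫ x in (0:ℝ)..x₁, evenSol x * φ x) -
      ∫ x in (0:ℝ)..x₁, 2 * Qt x ^ 2 * Ht x ^ 2 / μ ^ 2 * (evenSol x * φ x) := by
    have hI := integral_eq_sub_of_hasDerivAt (a := 0) (b := x₁)
      (f := fun x => (x - cubeMoment μ x) * (evenSol x * φ x))
      (f' := fun x => (1 - 2 * Qt x ^ 2 * Ht x ^ 2 / μ ^ 2) * (evenSol x * φ x) +
        (x - cubeMoment μ x) * (evenSolDeriv x * φ x + evenSol x * φ' x))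
      (fun x _ => ((hasDerivAt_id x).sub (hasDerivAt_cubeMoment μ x)).mul (hprod x))
      (Continuous.intervalIntegrable (by fun_prop) _ _)
    have h0 : cubeMoment μ 0 = 0 := by simp [cubeMoment, Ht_zero]
    simp only [h0, sub_self, zero_mul, sub_zero] at hI
    rw [← intervalIntegral.integral_sub (i2.intervalIntegrable _ _) (i1.intervalIntegrable _ _),
      mul_comm, ← hI]
    refine integral_mono_on hx₁.le (Continuous.intervalIntegrable (by fun_prop) _ _)
      (Continuous.intervalIntegrable (by fun_prop) _ _) fun x hx => ?_
    have h1 := h.mul_antitoneOn hX hfX ⟨hx.1, hx.2.trans hx₁X⟩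
    have h2 := cubeMoment_le h.le_mu hx.1 ((strictMono_Ht.monotone (hx.2.trans hx₁X)).trans hH)
    have := mul_nonpos_of_nonneg_of_nonpos (sub_nonneg.2 h2) h1
    linarith
  have hout : ∫ x in x₁..X, 2 * Qt x ^ 2 * Ht x ^ 2 / μ ^ 2 * (evenSol x * φ x) ≤
      evenSol x₁ * φ x₁ * (cubeMoment μ X - cubeMoment μ x₁) := by
    have i3 : Continuous fun x => 2 * Qt x ^ 2 * Ht x ^ 2 / μ ^ 2 := by fun_prop
    rw [← integral_eq_sub_of_hasDerivAt (fun x _ => hasDerivAt_cubeMoment μ x)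
      (i3.intervalIntegrable _ _), mul_comm, ← intervalIntegral.integral_mul_const]
    refine integral_mono_on hx₁X (i1.intervalIntegrable _ _)
      (Continuous.intervalIntegrable (by fun_prop) _ _) fun x hx => ?_
    exact mul_le_mul_of_nonneg_left (hanti ⟨hx₁.le, hx₁X⟩ ⟨hx₁.le.trans hx.1, hx.2⟩ hx.1)
      (by positivity)
  linarith

end IsGroundState

end Even

section EvenMoment

variable {μ x₁ X R : ℝ} {φ φ' σ w w' : ℝ → ℝ}

lemma evenSol_pos (hX : 0 < X) (hfX : evenSol X = 0) {x : ℝ} (hx : 0 ≤ x) (hxX : x < X) :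
    0 < evenSol x :=
  hfX ▸ strictAntiOn_evenSol hx hX.le hxX

lemma isInnerSol_evenSol (hX : 0 < X) (hfX : evenSol X = 0) (hx₁ : 0 < x₁) (hx₁X : x₁ < X) :
    IsInnerSol x₁ evenSol evenSolDeriv where
  x_pos := hx₁
  hasDerivAt := hasDerivAt_evenSol
  hasDerivAt' := hasDerivAt_evenSolDeriv
  pos _ hx := evenSol_pos hX hfX hx.1 (hx.2.trans_lt hx₁X)

lemma logDerivJump_evenSol (hx₁ : 0 < x₁) (hf : 0 < evenSol x₁) :
    logDerivJump x₁ evenSol evenSolDeriv = 3 / 4 / (evenSol x₁ * Ht x₁) := by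
  have := Ht_pos hx₁
  rw [logDerivJump, ← wronskian_evenSol x₁]
  field_simp

lemma innerMoment_mono (hw : Continuous w) (hσ : Continuous σ) {r : ℝ}
    (hpos : ∀ x ∈ Icc 0 r, 0 ≤ w x * σ x) : MonotoneOn (innerMoment w σ) (Icc 0 r) := by
  refine monotoneOn_of_deriv_nonneg (convex_Icc 0 r) (continuous_innerMoment hw hσ).continuousOn
    (fun x _ => (hasDerivAt_innerMoment hw hσ x).differentiableAt.differentiableWithinAt)
    fun x hx => ?_
  rw [(hasDerivAt_innerMoment hw hσ x).deriv]
  exact hpos x (interior_subset hx)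

lemma outerMoment_anti (hσ : Continuous σ) (hpos : ∀ x, 0 ≤ x → 0 ≤ σ x) (R : ℝ) :
    AntitoneOn (outerMoment σ R) (Ici 0) := by
  refine antitoneOn_of_deriv_nonpos (convex_Ici 0) (continuous_outerMoment hσ R).continuousOn
    (fun x _ => (hasDerivAt_outerMoment hσ R x).differentiableAt.differentiableWithinAt)
    fun x hx => ?_
  rw [(hasDerivAt_outerMoment hσ R x).deriv]
  have hx0 : 0 ≤ x := interior_subset hx
  exact neg_nonpos.2 (mul_nonneg (Ht_nonneg hx0) (hpos x hx0))

lemma outerMoment_mono_right (hσ : Continuous σ) (hpos : ∀ x, 0 ≤ x → 0 ≤ σ x) (hx₁ : 0 < x₁)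
    {R' : ℝ} (hR : x₁ ≤ R) (hRR' : R ≤ R') : outerMoment σ R x₁ ≤ outerMoment σ R' x₁ := by
  have hc := continuous_Ht.mul hσ
  have h := intervalIntegral.integral_add_adjacent_intervals
    (hc.intervalIntegrable (μ := volume) x₁ R) (hc.intervalIntegrable R R')
  have h2 : 0 ≤ ∫ x in R..R', Ht x * σ x := integral_nonneg hRR' fun x hx => by
    have hx0 : 0 ≤ x := hx₁.le.trans (hR.trans hx.1)
    exact mul_nonneg (Ht_nonneg hx0) (hpos x hx0)
  simp only [Pi.mul_apply] at h
  rw [outerMoment, outerMoment, ← h]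
  linarith

lemma outerMoment_pos (hσ : Continuous σ) (hpos : ∀ x, 0 < x → 0 < σ x) (hx₁ : 0 < x₁)
    (hR : x₁ < R) : 0 < outerMoment σ R x₁ :=
  intervalIntegral_pos_of_pos_on ((continuous_Ht.mul hσ).intervalIntegrable _ _)
    (fun x hx => mul_pos (Ht_pos (hx₁.trans hx.1)) (hpos x (hx₁.trans hx.1))) hR

lemma hasDerivAt_Ht_div_evenSol {x : ℝ} (hf : evenSol x ≠ 0) :
    HasDerivAt (fun x => Ht x / evenSol x) (3 / 4 / evenSol x ^ 2) x := by
  refine ((hasDerivAt_Ht x).div (hasDerivAt_evenSol x) hf).congr_deriv ?_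
  rw [← wronskian_evenSol x]
  ring

lemma hasDerivAt_evenSol_div_Ht {x : ℝ} (hH : Ht x ≠ 0) :
    HasDerivAt (fun x => evenSol x / Ht x) (-(3 / 4 / Ht x ^ 2)) x := by
  refine ((hasDerivAt_evenSol x).div (hasDerivAt_Ht x) hH).congr_deriv ?_
  rw [← wronskian_evenSol x]
  ring

lemma inner_normSq_le (h : IsInnerSol x₁ evenSol evenSolDeriv) (hσ : Continuous σ)
    (hpos : ∀ x, 0 ≤ x → 0 ≤ σ x) :
    3 / 4 * ∫ x in (0:ℝ)..x₁, (innerMoment evenSol σ x / evenSol x) ^ 2 ≤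
      innerMoment evenSol σ x₁ ^ 2 * (Ht x₁ / evenSol x₁) := by
  have hf := continuous_evenSol
  have hA := continuous_innerMoment hf hσ
  have hne : ∀ x ∈ uIcc 0 x₁, evenSol x ≠ 0 := fun x hx => by
    rw [uIcc_of_le h.x_pos.le] at hx
    exact (h.pos x hx).ne'
  have hne2 : ∀ x ∈ uIcc 0 x₁, evenSol x ^ 2 ≠ 0 := fun x hx => pow_ne_zero 2 (hne x hx)
  have i1 : IntervalIntegrable (fun x => 3 / 4 / evenSol x ^ 2) volume 0 x₁ :=
    (continuousOn_const.div (by fun_prop) hne2).intervalIntegrable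
  have i2 : IntervalIntegrable (fun x => (innerMoment evenSol σ x / evenSol x) ^ 2) volume 0 x₁ :=
    ((hA.continuousOn.div hf.continuousOn hne).pow 2).intervalIntegrable
  have key := integral_eq_sub_of_hasDerivAt
    (fun x hx => hasDerivAt_Ht_div_evenSol (hne x hx)) i1
  rw [Ht_zero, zero_div, sub_zero] at key
  rw [← key, ← intervalIntegral.integral_const_mul, ← intervalIntegral.integral_const_mul]
  refine integral_mono_on h.x_pos.le (i2.const_mul _) (i1.const_mul _) fun x hx => ?_
  have hmono := innerMoment_mono (r := x₁) hf hσ fun y hy =>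
    mul_nonneg (h.pos y hy).le (hpos y hy.1)
  have h1 : innerMoment evenSol σ x ≤ innerMoment evenSol σ x₁ :=
    hmono hx (right_mem_Icc.2 h.x_pos.le) hx.2
  have h2 : 0 ≤ innerMoment evenSol σ x := by
    have := hmono (left_mem_Icc.2 h.x_pos.le) hx hx.1
    simpa [innerMoment] using this
  have h3 := h.pos x hx
  calc 3 / 4 * (innerMoment evenSol σ x / evenSol x) ^ 2
      = innerMoment evenSol σ x ^ 2 * (3 / 4 / evenSol x ^ 2) := by ring
    _ ≤ _ := by gcongr

lemma outer_normSq_le (hx₁ : 0 < x₁) (hσ : Continuous σ)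
    (hpos : ∀ x, 0 ≤ x → 0 ≤ σ x) (hR : x₁ ≤ R) :
    3 / 4 * ∫ x in x₁..R, (outerMoment σ R x / Ht x) ^ 2 ≤
      outerMoment σ R x₁ * (evenSol x₁ / Ht x₁ * outerMoment σ R x₁ -
        ∫ x in x₁..R, evenSol x * σ x) := by
  have hf := continuous_evenSol
  have hP := continuous_outerMoment hσ R
  have hHc := continuous_Ht
  have hne : ∀ x ∈ uIcc x₁ R, Ht x ≠ 0 := fun x hx => by
    rw [uIcc_of_le hR] at hx
    exact (Ht_pos (hx₁.trans_le hx.1)).ne'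
  have hne2 : ∀ x ∈ uIcc x₁ R, Ht x ^ 2 ≠ 0 := fun x hx => pow_ne_zero 2 (hne x hx)
  set c := evenSol x₁ / Ht x₁
  have hPR : outerMoment σ R R = 0 := by simp [outerMoment]
  have i1 : IntervalIntegrable (fun x => 3 / 4 / Ht x ^ 2 * outerMoment σ R x) volume x₁ R :=
    ((continuousOn_const.div (by fun_prop) hne2).mul hP.continuousOn).intervalIntegrable
  have i2 : IntervalIntegrable (fun x => c * (Ht x * σ x) - evenSol x * σ x) volume x₁ R :=
    Continuous.intervalIntegrable (by fun_prop) _ _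
  have i3 : IntervalIntegrable (fun x => (outerMoment σ R x / Ht x) ^ 2) volume x₁ R :=
    ((hP.continuousOn.div hHc.continuousOn hne).pow 2).intervalIntegrable
  have key := integral_eq_sub_of_hasDerivAt (a := x₁) (b := R)
    (f := fun x => (c - evenSol x / Ht x) * outerMoment σ R x)
    (f' := fun x => 3 / 4 / Ht x ^ 2 * outerMoment σ R x -
      (c * (Ht x * σ x) - evenSol x * σ x))
    (fun x hx => by
      refine (((hasDerivAt_evenSol_div_Ht (hne x hx)).const_sub c).mul
        (hasDerivAt_outerMoment hσ R x)).congr_deriv ?_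
      have := hne x hx
      field_simp
      ring) (i1.sub i2)
  simp only [hPR, mul_zero, c, sub_self, zero_mul] at key
  rw [intervalIntegral.integral_sub i1 i2, intervalIntegral.integral_sub
    (Continuous.intervalIntegrable (by fun_prop) _ _)
    (Continuous.intervalIntegrable (by fun_prop) _ _),
    intervalIntegral.integral_const_mul, sub_eq_zero] at key
  change _ = c * outerMoment σ R x₁ - _ at key
  rw [← key, ← intervalIntegral.integral_const_mul, ← intervalIntegral.integral_const_mul]
  refine integral_mono_on hR (i3.const_mul _) (i1.const_mul _) fun x hx => ?_
  have hx0 := hx₁.trans_le hx.1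
  have hanti := outerMoment_anti hσ hpos R
  have h1 : outerMoment σ R x ≤ outerMoment σ R x₁ := hanti hx₁.le hx0.le hx.1
  have h2 : 0 ≤ outerMoment σ R x := hPR ▸ hanti hx0.le (hx0.le.trans hx.2) hx.2
  have h3 := Ht_pos hx0
  calc 3 / 4 * (outerMoment σ R x / Ht x) ^ 2
      = outerMoment σ R x * (3 / 4 / Ht x ^ 2 * outerMoment σ R x) := by ring
    _ ≤ _ := by gcongr

lemma sub_splitNormSq_ge (h : IsInnerSol x₁ evenSol evenSolDeriv) (hσ : Continuous σ)
    (hpos : ∀ x, 0 ≤ x → 0 ≤ σ x) (hR : x₁ ≤ R) :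
    outerMoment σ R x₁ / (evenSol x₁ * Ht x₁) *
        ((∫ x in (0:ℝ)..x₁, evenSol x * σ x) + ∫ x in (0:ℝ)..R, evenSol x * σ x) ≤
      splitMoment x₁ evenSol σ R ^ 2 -
        logDerivJump x₁ evenSol evenSolDeriv * splitNormSq x₁ evenSol σ R := by
  have hf := h.pos x₁ (right_mem_Icc.2 h.x_pos.le)
  have hH := Ht_pos h.x_pos
  have h1 := inner_normSq_le h hσ hpos
  have h2 := outer_normSq_le h.x_pos hσ hpos hR
  have hc := continuous_evenSol.mul hσ
  have h3 := intervalIntegral.integral_add_adjacent_intervals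
    (hc.intervalIntegrable (μ := volume) 0 x₁) (hc.intervalIntegrable x₁ R)
  simp only [Pi.mul_apply] at h3
  rw [logDerivJump_evenSol h.x_pos hf, splitMoment, splitNormSq, ← h3]
  change _ * (innerMoment evenSol σ x₁ + (innerMoment evenSol σ x₁ + _)) ≤ _
  set A := innerMoment evenSol σ x₁
  set P := outerMoment σ R x₁
  set I := ∫ x in x₁..R, evenSol x * σ x
  set f := evenSol x₁
  set H := Ht x₁
  rw [show ∀ s t : ℝ, 3 / 4 / (f * H) * (s + t) = (3 / 4 * s + 3 / 4 * t) / (f * H) by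
    intros; ring]
  have h4 := div_le_div_of_nonneg_right (add_le_add h1 h2) (mul_pos hf hH).le
  refine le_trans (le_of_eq ?_) (sub_le_sub_left h4 _)
  field_simp
  ring

lemma IsGroundState.exists_moment_bound (h : IsGroundState μ φ φ') (hφ : Integrable φ) :
    ∃ x₁ κ θ R₀ : ℝ, IsInnerSol x₁ evenSol evenSolDeriv ∧
      0 < logDerivJump x₁ evenSol evenSolDeriv ∧ 0 < κ ∧ θ < 1 ∧
      ∀ R, R₀ ≤ R → κ ≤ splitMoment x₁ evenSol φ R ∧
        logDerivJump x₁ evenSol evenSolDeriv * splitNormSq x₁ evenSol φ R ≤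
          θ * splitMoment x₁ evenSol φ R ^ 2 := by
  obtain ⟨X, hX, hfX, hHX, hX2⟩ := exists_evenSol_eq_zero
  have hn := cubeMoment_lt h.le_mu hX hHX hX2
  have hμ : 0 < μ := by linarith [h.le_mu]
  have hn0 : 0 < cubeMoment μ X := by
    have := Ht_pos hX
    unfold cubeMoment
    positivity
  obtain ⟨x₁, hnx, hx₁X⟩ := exists_between hn
  have hx₁ := hn0.trans hnx
  have hin := isInnerSol_evenSol hX hfX hx₁ hx₁X
  have hf := evenSol_pos hX hfX hx₁.le hx₁X
  have hH := Ht_pos hx₁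
  have hφc := h.continuous
  have hφ0 : ∀ x, 0 ≤ x → 0 ≤ φ x := fun x _ => (h.pos x).le
  set A := innerMoment evenSol φ x₁ / evenSol x₁ with hA
  set p := outerMoment φ (X + 1) x₁
  have hp : 0 < p := outerMoment_pos hφc (fun x _ => h.pos x) hx₁ (by linarith)
  have hA0 : 0 ≤ A := div_nonneg (integral_nonneg hx₁.le fun x hx =>
    mul_nonneg (hin.pos x hx).le (h.pos x).le) hf.le
  set M := A + (∫ x, φ x) / Ht x₁
  have hM : ∀ R, X + 1 ≤ R → splitMoment x₁ evenSol φ R ≤ M := fun R hR => by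
    have hle : x₁ ≤ R := by linarith
    have h1 : outerMoment φ R x₁ ≤ ∫ x, φ x := by
      calc outerMoment φ R x₁ ≤ ∫ x in x₁..R, φ x :=
            integral_mono_on hle ((continuous_Ht.mul hφc).intervalIntegrable _ _)
              (hφc.intervalIntegrable _ _) fun x _ =>
                mul_le_of_le_one_left (h.pos x).le (Ht_lt_one x).le
        _ ≤ ∫ x, φ x := by
            rw [integral_of_le hle]
            exact setIntegral_le_integral hφ (ae_of_all _ fun x => (h.pos x).le)
    exact add_le_add le_rfl (div_le_div_of_nonneg_right h1 hH.le)
  have hκ : ∀ R, X + 1 ≤ R → p / Ht x₁ ≤ splitMoment x₁ evenSol φ R := fun R hR => by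
    have := outerMoment_mono_right hφc hφ0 hx₁ (by linarith) hR
    have h2 : p / Ht x₁ ≤ outerMoment φ R x₁ / Ht x₁ := by gcongr
    rw [splitMoment]
    linarith
  have hM0 : 0 < M := (div_pos hp hH).trans_le ((hκ _ le_rfl).trans (hM _ le_rfl))
  set η := p / (evenSol x₁ * Ht x₁) * (evenSol x₁ * φ x₁ * (x₁ - cubeMoment μ X))
  have hδ : 0 < evenSol x₁ * φ x₁ * (x₁ - cubeMoment μ X) :=
    mul_pos (mul_pos hf (h.pos x₁)) (sub_pos.2 hnx)
  have hη : 0 < η := mul_pos (div_pos hp (mul_pos hf hH)) hδ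
  refine ⟨x₁, p / Ht x₁, 1 - η / M ^ 2, X + 1, hin, ?_, div_pos hp hH,
    sub_lt_self 1 (div_pos hη (pow_pos hM0 2)), fun R hR => ⟨hκ R hR, ?_⟩⟩
  · rw [logDerivJump_evenSol hx₁ hf]
    positivity
  · have h1 := sub_splitNormSq_ge hin hφc hφ0 (R := R) (by linarith)
    have h2 := h.le_integral_add hX hfX hHX hx₁ hx₁X.le (R := R) (by linarith)
    have h3 := outerMoment_mono_right hφc hφ0 hx₁ (by linarith) hR
    have h4 : η ≤ outerMoment φ R x₁ / (evenSol x₁ * Ht x₁) *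
        ((∫ x in (0:ℝ)..x₁, evenSol x * φ x) + ∫ x in (0:ℝ)..R, evenSol x * φ x) := by
      refine mul_le_mul ?_ h2 hδ.le (div_nonneg (hp.le.trans h3) (mul_pos hf hH).le)
      gcongr
    have h5 : η / M ^ 2 * splitMoment x₁ evenSol φ R ^ 2 ≤ η := by
      have h6 : 0 ≤ splitMoment x₁ evenSol φ R := (div_pos hp hH).le.trans (hκ R hR)
      calc _ ≤ η / M ^ 2 * M ^ 2 := by
            have := hM R hR
            gcongr
        _ = η := by field_simp
    linarith

end EvenMoment

section OddMoment

variable {x₁ X R τ : ℝ}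

lemma isInnerSol_oddSol (hX : 0 < X) (hfX : evenSol X = 0) (hx₁ : 0 < x₁) (hx₁X : x₁ < X)
    (hτ : 0 < τ) :
    IsInnerSol x₁ (fun x => Ht x + τ * evenSol x)
      (fun x => Qt x ^ 2 / 3 + τ * evenSolDeriv x) where
  x_pos := hx₁
  hasDerivAt x := (hasDerivAt_Ht x).add ((hasDerivAt_evenSol x).const_mul τ)
  hasDerivAt' x := ((hasDerivAt_Ht_deriv x).add
    ((hasDerivAt_evenSolDeriv x).const_mul τ)).congr_deriv (by ring)
  pos x hx := by
    have := Ht_nonneg hx.1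
    have := evenSol_pos hX hfX hx.1 (hx.2.trans_lt hx₁X)
    positivity

lemma logDerivJump_oddSol (hx₁ : 0 < x₁) (hf : 0 < Ht x₁ + τ * evenSol x₁) :
    logDerivJump x₁ (fun x => Ht x + τ * evenSol x) (fun x => Qt x ^ 2 / 3 + τ * evenSolDeriv x) =
      τ * (3 / 4) / ((Ht x₁ + τ * evenSol x₁) * Ht x₁) := by
  have := Ht_pos hx₁
  rw [logDerivJump, ← wronskian_evenSol x₁]
  field_simp
  ring

lemma continuous_oddWeight : Continuous fun x => Qt x ^ 2 * Ht x ^ 3 := by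
  have := continuous_Qt
  have := continuous_Ht
  fun_prop

lemma oddWeight_nonneg {x : ℝ} (hx : 0 ≤ x) : 0 ≤ Qt x ^ 2 * Ht x ^ 3 := by
  have := Ht_nonneg hx
  positivity

lemma innerMoment_oddSol_le (hX : 0 < X) (hfX : evenSol X = 0) (hτ : 0 < τ) (hτ1 : τ ≤ 1) {x : ℝ}
    (hx : 0 ≤ x) (hxX : x < X) :
    innerMoment (fun x => Ht x + τ * evenSol x) (fun x => Qt x ^ 2 * Ht x ^ 3) x ≤
      3 / 2 * Ht x := by
  have hf := continuous_evenSol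
  have hQ := continuous_Qt
  have hH := continuous_Ht
  have key := integral_eq_sub_of_hasDerivAt (a := 0) (b := x)
    (f := fun y => 3 / 2 * Ht y ^ 4) (f' := fun y => 2 * (Qt y ^ 2 * Ht y ^ 3))
    (fun y _ => (((hasDerivAt_Ht y).pow 4).const_mul (3 / 2)).congr_deriv (by norm_num; ring))
    (Continuous.intervalIntegrable (by fun_prop) _ _)
  have h1 : Ht x ^ 4 ≤ Ht x := by
    have := pow_le_one₀ (n := 3) (Ht_nonneg hx) (Ht_lt_one x).le
    nlinarith [Ht_nonneg hx]
  have h2 : innerMoment (fun x => Ht x + τ * evenSol x) (fun x => Qt x ^ 2 * Ht x ^ 3) x ≤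
      3 / 2 * Ht x ^ 4 := by
    simp only [Ht_zero, ne_eq, OfNat.ofNat_ne_zero, not_false_eq_true, zero_pow, mul_zero,
      sub_zero] at key
    rw [← key, innerMoment]
    refine integral_mono_on hx (Continuous.intervalIntegrable (by fun_prop) _ _)
      (Continuous.intervalIntegrable (by fun_prop) _ _) fun y hy => ?_
    have h3 : evenSol y ≤ 1 := by
      rw [← evenSol_zero]
      exact strictAntiOn_evenSol.antitoneOn self_mem_Ici hy.1 hy.1
    have h4 := evenSol_pos hX hfX hy.1 (hy.2.trans_lt hxX)
    have h5 : Ht y + τ * evenSol y ≤ 2 := by nlinarith [Ht_lt_one y]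
    exact mul_le_mul_of_nonneg_right h5 (oddWeight_nonneg hy.1)
  linarith

lemma integral_Qt_sq (a b : ℝ) : ∫ x in a..b, Qt x ^ 2 = 3 * (Ht b - Ht a) := by
  have hQ := continuous_Qt
  have h := integral_eq_sub_of_hasDerivAt (a := a) (b := b) (fun y _ => hasDerivAt_Ht y)
    (Continuous.intervalIntegrable (by fun_prop) _ _)
  rw [intervalIntegral.integral_div] at h
  linarith

lemma outerMoment_oddWeight_le {x : ℝ} (hx : 0 ≤ x) (hR : x ≤ R) :
    outerMoment (fun x => Qt x ^ 2 * Ht x ^ 3) R x ≤ 2 * Qt x := by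
  have hQ := continuous_Qt
  have hH := continuous_Ht
  have h1 : outerMoment (fun x => Qt x ^ 2 * Ht x ^ 3) R x ≤ ∫ y in x..R, Qt y ^ 2 := by
    refine integral_mono_on hR (Continuous.intervalIntegrable (by fun_prop) _ _)
      (Continuous.intervalIntegrable (by fun_prop) _ _) fun y hy => ?_
    have := pow_le_one₀ (n := 4) (Ht_nonneg (hx.trans hy.1)) (Ht_lt_one y).le
    nlinarith [sq_nonneg (Qt y)]
  rw [integral_Qt_sq] at h1
  linarith [Ht_lt_one R, one_sub_Ht_le hx]

lemma splitNormSq_oddSol_le (hX : 0 < X) (hfX : evenSol X = 0) (hx₁ : 0 < x₁) (hx₁X : x₁ < X)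
    (hτ : 0 < τ) (hτ1 : τ ≤ 1) (hR : x₁ ≤ R) :
    splitNormSq x₁ (fun x => Ht x + τ * evenSol x) (fun x => Qt x ^ 2 * Ht x ^ 3) R ≤
      9 / 4 * x₁ + 12 / Ht x₁ ^ 2 := by
  have hw := (isInnerSol_oddSol hX hfX hx₁ hx₁X hτ).continuous
  have hwp := (isInnerSol_oddSol hX hfX hx₁ hx₁X hτ).pos
  have hσ := continuous_oddWeight
  have hQ := continuous_Qt
  have hH := continuous_Ht
  have hH1 := Ht_pos hx₁
  have hA := continuous_innerMoment hw hσ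
  have hP := continuous_outerMoment hσ R
  rw [splitNormSq]
  refine add_le_add ?_ ?_
  · calc _ ≤ ∫ _ in (0:ℝ)..x₁, (9 / 4 : ℝ) := by
          refine integral_mono_on hx₁.le (ContinuousOn.intervalIntegrable ?_)
            intervalIntegrable_const fun x hx => ?_
          · rw [uIcc_of_le hx₁.le]
            exact (hA.continuousOn.div hw.continuousOn fun x hx => (hwp x hx).ne').pow 2
          · have h1 := innerMoment_oddSol_le hX hfX hτ hτ1 hx.1 (hx.2.trans_lt hx₁X)
            have h2 : 0 ≤ innerMoment (fun x => Ht x + τ * evenSol x)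
                (fun x => Qt x ^ 2 * Ht x ^ 3) x := integral_nonneg hx.1 fun y hy =>
              mul_nonneg (hwp y ⟨hy.1, hy.2.trans hx.2⟩).le (oddWeight_nonneg hy.1)
            have h3 := mul_pos hτ (evenSol_pos hX hfX hx.1 (hx.2.trans_lt hx₁X))
            have h4 : innerMoment (fun x => Ht x + τ * evenSol x)
                (fun x => Qt x ^ 2 * Ht x ^ 3) x / (Ht x + τ * evenSol x) ≤ 3 / 2 := by
              rw [div_le_iff₀ (hwp x hx)]
              linarith
            have h5 := div_nonneg h2 (hwp x hx).le
            nlinarith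
      _ = 9 / 4 * x₁ := by simp; ring
  · calc _ ≤ ∫ x in x₁..R, 4 / Ht x₁ ^ 2 * Qt x ^ 2 := by
          refine integral_mono_on hR (ContinuousOn.intervalIntegrable ?_)
            (Continuous.intervalIntegrable (by fun_prop) _ _) fun x hx => ?_
          · rw [uIcc_of_le hR]
            exact (hP.continuousOn.div hH.continuousOn
              fun x hx => (Ht_pos (hx₁.trans_le hx.1)).ne').pow 2
          · have hx0 := hx₁.trans_le hx.1
            have h1 := outerMoment_oddWeight_le hx0.le hx.2
            have h2 : 0 ≤ outerMoment (fun x => Qt x ^ 2 * Ht x ^ 3) R x :=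
              integral_nonneg hx.2 fun y hy => mul_nonneg (Ht_nonneg (hx0.le.trans hy.1))
                (oddWeight_nonneg (hx0.le.trans hy.1))
            have h3 := strictMono_Ht.monotone hx.1
            calc (outerMoment (fun x => Qt x ^ 2 * Ht x ^ 3) R x / Ht x) ^ 2
                ≤ (2 * Qt x / Ht x₁) ^ 2 := by
                  have := Qt_pos x
                  have := div_nonneg h2 (Ht_pos hx0).le
                  gcongr
              _ = _ := by ring
      _ = 4 / Ht x₁ ^ 2 * (3 * (Ht R - Ht x₁)) := by
          rw [intervalIntegral.integral_const_mul, integral_Qt_sq]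
      _ ≤ 4 / Ht x₁ ^ 2 * 3 := by
          have := Ht_lt_one R
          gcongr
          linarith
      _ = _ := by ring

lemma exists_odd_moment_bound : ∃ (x₁ κ θ R₀ : ℝ) (w w' : ℝ → ℝ), IsInnerSol x₁ w w' ∧
    0 < logDerivJump x₁ w w' ∧ 0 < κ ∧ θ < 1 ∧
      ∀ R, R₀ ≤ R → κ ≤ splitMoment x₁ w (fun x => Qt x ^ 2 * Ht x ^ 3) R ∧
        logDerivJump x₁ w w' * splitNormSq x₁ w (fun x => Qt x ^ 2 * Ht x ^ 3) R ≤
          θ * splitMoment x₁ w (fun x => Qt x ^ 2 * Ht x ^ 3) R ^ 2 := by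
  obtain ⟨X, hX, hfX, -, -⟩ := exists_evenSol_eq_zero
  obtain ⟨x₁, hx₁, hx₁X⟩ := exists_between hX
  have hH := Ht_pos hx₁
  have hσ := continuous_oddWeight
  have hf := evenSol_pos hX hfX hx₁.le hx₁X
  set p := outerMoment (fun x => Qt x ^ 2 * Ht x ^ 3) (x₁ + 1) x₁
  have hp : 0 < p := outerMoment_pos hσ (fun x hx => by
    have := Ht_pos hx
    have := Qt_pos x
    positivity) hx₁ (by linarith)
  set κ := p / Ht x₁
  have hκ : 0 < κ := div_pos hp hH
  set M := 9 / 4 * x₁ + 12 / Ht x₁ ^ 2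
  have hM : 0 < M := by positivity
  obtain ⟨τ, hτ, hτ1, hτM⟩ : ∃ τ, 0 < τ ∧ τ ≤ 1 ∧ τ * (3 / 4) / Ht x₁ ^ 2 * M ≤ 1 / 2 * κ ^ 2 := by
    refine ⟨min 1 (1 / 2 * κ ^ 2 / (3 / 4 / Ht x₁ ^ 2 * M)), lt_min one_pos (by positivity),
      min_le_left _ _, ?_⟩
    calc _ ≤ 1 / 2 * κ ^ 2 / (3 / 4 / Ht x₁ ^ 2 * M) * (3 / 4) / Ht x₁ ^ 2 * M := by
          gcongr
          exact min_le_right _ _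
      _ = _ := by field_simp
  have hin := isInnerSol_oddSol hX hfX hx₁ hx₁X hτ
  have hw1 := hin.pos x₁ (right_mem_Icc.2 hx₁.le)
  have hjump := logDerivJump_oddSol hx₁ hw1
  have hβ : 0 < τ * (3 / 4) / ((Ht x₁ + τ * evenSol x₁) * Ht x₁) := by positivity
  refine ⟨x₁, κ, 1 / 2, x₁ + 1, _, _, hin, hjump ▸ hβ, hκ, by norm_num, fun R hR => ?_⟩
  have hm : κ ≤ splitMoment x₁ (fun x => Ht x + τ * evenSol x)
      (fun x => Qt x ^ 2 * Ht x ^ 3) R := by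
    have h1 := outerMoment_mono_right hσ (fun x hx => oddWeight_nonneg hx) hx₁ (by linarith) hR
    have h2 : κ ≤ outerMoment (fun x => Qt x ^ 2 * Ht x ^ 3) R x₁ / Ht x₁ :=
      div_le_div_of_nonneg_right h1 hH.le
    have h3 : 0 ≤ innerMoment (fun x => Ht x + τ * evenSol x)
        (fun x => Qt x ^ 2 * Ht x ^ 3) x₁ := integral_nonneg hx₁.le fun y hy =>
      mul_nonneg (hin.pos y hy).le (oddWeight_nonneg hy.1)
    have h4 := div_nonneg h3 hw1.le
    rw [splitMoment]
    linarith
  refine ⟨hm, ?_⟩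
  have hN := splitNormSq_oddSol_le hX hfX hx₁ hx₁X hτ hτ1 (R := R) (by linarith)
  rw [hjump]
  calc _ ≤ τ * (3 / 4) / ((Ht x₁ + τ * evenSol x₁) * Ht x₁) * M :=
        mul_le_mul_of_nonneg_left hN hβ.le
    _ ≤ τ * (3 / 4) / Ht x₁ ^ 2 * M := by
        rw [sq]
        gcongr
        linarith [mul_pos hτ hf]
    _ ≤ 1 / 2 * κ ^ 2 := hτM
    _ ≤ _ := by gcongr

end OddMoment

section Parity

variable {u g f σ : ℝ → ℝ} {s : ℝ}

/-- The even (`s = 1`) or odd (`s = -1`) part of a function. -/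
noncomputable def parityPart (s : ℝ) (f : ℝ → ℝ) (x : ℝ) : ℝ := 1 / 2 * (f x + s * f (-x))

lemma hasDensity_parityPart (h : HasDensity u g) (s : ℝ) :
    HasDensity (parityPart s u) (parityPart (-s) g) := by
  convert (h.add (h.comp_neg.const_mul s)).const_mul (1 / 2) using 1 <;>
    (ext x; simp [parityPart])

lemma memLp_parityPart (h : MemLp f 2) (s : ℝ) : MemLp (parityPart s f) 2 := by
  have h1 : MemLp (fun x => f (-x)) 2 :=
    h.comp_measurePreserving (Measure.measurePreserving_neg volume)
  exact (h.add (h1.const_mul s)).const_mul (1 / 2)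

lemma integral_eq_two_mul_parityPart (h : Integrable f) :
    ∫ x, f x = 2 * ∫ x in Ioi 0, parityPart 1 f x := by
  have h1 : ∫ x in Iic 0, f x = ∫ x in Ioi 0, f (-x) := by
    rw [integral_comp_neg_Ioi, neg_zero]
  rw [← intervalIntegral.integral_Iic_add_Ioi h.integrableOn h.integrableOn, h1, add_comm,
    ← integral_add h.integrableOn h.comp_neg.integrableOn, ← MeasureTheory.integral_const_mul]
  congr 1
  ext x
  simp [parityPart]

lemma integrable_mul_parityPart (h : Integrable fun x => σ x * u x)
    (hσ : ∀ x, σ (-x) = s * σ x) : Integrable fun x => σ x * parityPart s u x := by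
  refine ((h.add h.comp_neg).const_mul (1 / 2)).congr (ae_of_all _ fun x => ?_)
  simp only [Pi.add_apply, parityPart, hσ]
  ring

lemma integral_mul_parityPart (h : Integrable fun x => σ x * u x) (h0 : ∫ x, σ x * u x = 0)
    (hσ : ∀ x, σ (-x) = s * σ x) : ∫ x in Ioi 0, σ x * parityPart s u x = 0 := by
  rw [integral_eq_two_mul_parityPart h] at h0
  have h1 : ∫ x in Ioi 0, parityPart 1 (fun x => σ x * u x) x = 0 := by linarith
  refine (MeasureTheory.integral_congr_ae (ae_of_all _ fun x => ?_)).trans h1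
  simp only [parityPart, hσ]
  ring

end Parity

section Decay

variable {u g φ : ℝ → ℝ} {C k : ℝ}

lemma integrable_exp_neg_mul_abs (hk : 0 < k) : Integrable fun x : ℝ => exp (-k * |x|) := by
  rw [← integrableOn_univ, ← Iic_union_Ioi (a := (0 : ℝ)), integrableOn_union]
  constructor
  · refine (integrableOn_exp_mul_Iic hk 0).congr_fun (fun x hx => ?_) measurableSet_Iic
    rw [abs_of_nonpos hx]
    ring_nf
  · refine (exp_neg_integrableOn_Ioi 0 hk).congr_fun (fun x hx => ?_) measurableSet_Ioi
    simp only
    rw [abs_of_pos hx]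

lemma HasDensity.abs_le (h : HasDensity u g) (hg : Integrable fun x => g x ^ 2) (x : ℝ) :
    |u x| ≤ |u 0| + (∫ t, g t ^ 2) + |x| := by
  have hG : |∫ t in (0:ℝ)..x, g t ^ 2| ≤ ∫ t, g t ^ 2 := by
    rw [← Real.norm_eq_abs, norm_integral_eq_norm_integral_uIoc, Real.norm_eq_abs,
      abs_of_nonneg (integral_nonneg fun t => sq_nonneg _)]
    exact setIntegral_le_integral hg (ae_of_all _ fun t => sq_nonneg _)
  have h1 : |u x - u 0| ≤ |∫ t in (0:ℝ)..x, (g t ^ 2 + 1)| := by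
    rw [h.sub_eq 0 x, ← Real.norm_eq_abs]
    refine intervalIntegral.norm_integral_le_abs_of_norm_le (ae_of_all _ fun t => ?_)
      (hg.intervalIntegrable.add intervalIntegrable_const)
    rw [Real.norm_eq_abs, ← sq_abs]
    nlinarith [sq_nonneg (|g t| - 1), sq_nonneg (|g t| + 1)]
  rw [intervalIntegral.integral_add hg.intervalIntegrable intervalIntegrable_const] at h1
  have h2 : ∫ _ in (0:ℝ)..x, (1:ℝ) = x := by simp
  rw [h2] at h1
  have h3 := abs_add_le (∫ t in (0:ℝ)..x, g t ^ 2) x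
  have h4 := abs_sub_abs_le_abs_sub (u x) (u 0)
  linarith

lemma HasDensity.integrable_mul (h : HasDensity u g) (hg : Integrable fun x => g x ^ 2)
    (hφ : Continuous φ) (hk : 0 < k) (hdecay : ∀ x, |φ x| ≤ C * exp (-k * |x|)) :
    Integrable fun x => φ x * u x := by
  set a := |u 0| + ∫ t, g t ^ 2 with ha
  have ha0 : 0 ≤ a := add_nonneg (abs_nonneg _) (integral_nonneg fun t => sq_nonneg _)
  have hC : 0 ≤ C := by
    have := (abs_nonneg _).trans (hdecay 0)
    simpa using this
  refine ((integrable_exp_neg_mul_abs (half_pos hk)).const_mul (C * (a + 2 / k))).mono'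
    (hφ.mul h.continuous).aestronglyMeasurable (ae_of_all _ fun x => ?_)
  have h1 : |x| ≤ 2 / k * exp (k / 2 * |x|) := by
    have := add_one_le_exp (k / 2 * |x|)
    rw [div_mul_eq_mul_div, le_div_iff₀ hk]
    linarith
  have h2 : 1 ≤ exp (k / 2 * |x|) := one_le_exp (by positivity)
  have h3 : exp (-k * |x|) * exp (k / 2 * |x|) = exp (-(k / 2) * |x|) := by
    rw [← exp_add]
    ring_nf
  rw [norm_mul, Real.norm_eq_abs, Real.norm_eq_abs]
  calc |φ x| * |u x| ≤ C * exp (-k * |x|) * (a + |x|) :=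
        mul_le_mul (hdecay x) (h.abs_le hg x) (abs_nonneg _) (by positivity)
    _ ≤ C * exp (-k * |x|) * (a * exp (k / 2 * |x|) + 2 / k * exp (k / 2 * |x|)) := by
        gcongr
        exact le_mul_of_one_le_right ha0 h2
    _ = C * (a + 2 / k) * exp (-(k / 2) * |x|) := by
        rw [← h3]
        ring

lemma integrable_of_decay (hφ : Continuous φ) (hk : 0 < k)
    (hdecay : ∀ x, |φ x| ≤ C * exp (-k * |x|)) : Integrable φ :=
  ((integrable_exp_neg_mul_abs hk).const_mul C).mono' hφ.aestronglyMeasurable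
    (ae_of_all _ hdecay)

lemma isGroundState_of_decay {μ : ℝ} (hC2 : ContDiff ℝ 2 φ) (hpos : ∀ x, 0 < φ x)
    (heven : ∀ x, φ (-x) = φ x) (hμ : 0.808 ≤ μ)
    (heq : ∀ x, -(deriv (deriv φ) x) + Vpot x * φ x = -μ ^ 2 * φ x) (hk : 0 < k)
    (hdecay : ∀ x, |deriv φ x| ≤ C * exp (-k * |x|)) : IsGroundState μ φ (deriv φ) := by
  have h' : ∀ x, HasDerivAt (deriv φ) ((Vpot x + μ ^ 2) * φ x) x := fun x => by
    have hd : ContDiff ℝ 1 (deriv φ) :=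
      ((contDiff_succ_iff_deriv (n := 1)).1 (by simpa [one_add_one_eq_two] using hC2)).2.2
    refine (hd.differentiable one_ne_zero x).hasDerivAt.congr_deriv ?_
    linarith [heq x]
  have h0 : deriv φ 0 = 0 := by
    have := deriv_comp_neg φ 0
    rw [show (fun x => φ (-x)) = φ from funext heven, neg_zero] at this
    linarith
  have hlim : Tendsto (deriv φ) atTop (𝓝 0) := by
    refine squeeze_zero_norm hdecay ?_
    have h1 : Tendsto (fun x : ℝ => -k * |x|) atTop atBot :=
      tendsto_abs_atTop_atTop.const_mul_atTop_of_neg (neg_lt_zero.2 hk)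
    simpa using (tendsto_exp_atBot.comp h1).const_mul C
  exact ⟨hμ, fun x => (hC2.differentiable two_ne_zero x).hasDerivAt, h', hpos, h0,
    fun x hx => deriv_nonpos_of_tendsto h' hpos h0 hlim hx⟩

end Decay

section Assembly

variable {u g σ : ℝ → ℝ} {s : ℝ}

lemma HasDensity.locallyIntegrable (h : HasDensity u g) : LocallyIntegrable g := fun x =>
  ⟨Ioo (x - 1) (x + 1), Ioo_mem_nhds (by linarith) (by linarith),
    ((intervalIntegrable_iff_integrableOn_Ioc_of_le (by linarith)).1
      (h.intervalIntegrable (x - 1) (x + 1))).mono_set Ioo_subset_Ioc_self⟩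

/-- Functions in the energy space: `u` has density `g`, and `g` and `Q̃ u` are in `L²`. -/
structure HasFiniteEnergy (u g : ℝ → ℝ) : Prop where
  hasDensity : HasDensity u g
  memLp_density : MemLp g 2
  memLp_mul : MemLp (fun x => Qt x * u x) 2

namespace HasFiniteEnergy

lemma of_integrable (h : HasDensity u g) (hg : Integrable fun x => g x ^ 2)
    (hu : Integrable fun x => (Qt x * u x) ^ 2) : HasFiniteEnergy u g where
  hasDensity := h
  memLp_density := (memLp_two_iff_integrable_sq
    h.locallyIntegrable.aestronglyMeasurable).2 hg
  memLp_mul := (memLp_two_iff_integrable_sq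
    (continuous_Qt.mul h.continuous).aestronglyMeasurable).2 hu

lemma integrable_sq (h : HasFiniteEnergy u g) : Integrable fun x => g x ^ 2 :=
  h.memLp_density.integrable_sq

lemma integrable_Qt_sq (h : HasFiniteEnergy u g) :
    Integrable fun x => Qt x ^ 2 * u x ^ 2 := by
  simpa only [mul_pow] using h.memLp_mul.integrable_sq

lemma Qt_cube_le (x : ℝ) : Qt x ^ 3 * u x ^ 2 ≤ 3 / 2 * (Qt x ^ 2 * u x ^ 2) := by
  have := mul_le_mul_of_nonneg_right (Qt_le x)
    (mul_nonneg (sq_nonneg (Qt x)) (sq_nonneg (u x)))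
  linarith

lemma integrable_Qt_cube (h : HasFiniteEnergy u g) :
    Integrable fun x => Qt x ^ 3 * u x ^ 2 := by
  refine (h.integrable_Qt_sq.const_mul (3 / 2)).mono'
    (((continuous_Qt.pow 3).mul (h.hasDensity.continuous.pow 2)).aestronglyMeasurable)
    (ae_of_all _ fun x => ?_)
  have := Qt_pos x
  rw [Real.norm_of_nonneg (by positivity)]
  exact Qt_cube_le x

lemma integrable_energy (h : HasFiniteEnergy u g) :
    Integrable fun x => g x ^ 2 - 2 / 3 * Qt x ^ 3 * u x ^ 2 :=
  (h.integrable_sq.sub (h.integrable_Qt_cube.const_mul (2 / 3))).congr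
    (ae_of_all _ fun x => by simp [mul_assoc])

lemma integrable_oddWeight_mul (h : HasFiniteEnergy u g) :
    Integrable fun x => Qt x ^ 2 * Ht x ^ 3 * u x := by
  have hcont := continuous_oddWeight.mul h.hasDensity.continuous
  have hQ : Integrable fun x => Qt x ^ 2 := by
    have h_int := integrable_of_intervalIntegral_norm_bounded (μ := volume) (f := fun x => Qt x ^ 2)
      (l := atTop) (a := fun x : ℝ => -x) (b := id) 6
      (fun x => ((continuous_Qt.pow 2).integrableOn_Icc).mono_set Ioc_subset_Icc_self)
      tendsto_neg_atTop_atBot tendsto_id (Eventually.of_forall fun x => by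
        simp only [norm_pow, Real.norm_eq_abs, sq_abs, integral_Qt_sq, Ht_neg, id]
        linarith [Ht_lt_one x])
    exact h_int
  refine (hQ.add h.integrable_Qt_sq).mono' hcont.aestronglyMeasurable (ae_of_all _ fun x => ?_)
  have h1 : |Ht x| ≤ 1 := by
    rw [← sq_le_one_iff_abs_le_one, Ht_sq]
    linarith [Qt_pos x]
  have h2 : |Ht x| ^ 3 ≤ 1 := pow_le_one₀ (abs_nonneg _) h1
  rw [norm_mul, norm_mul, norm_pow, norm_pow, Real.norm_eq_abs, Real.norm_eq_abs,
    Real.norm_eq_abs, sq_abs, Pi.add_apply]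
  calc Qt x ^ 2 * |Ht x| ^ 3 * |u x| ≤ Qt x ^ 2 * 1 * |u x| := by gcongr
    _ ≤ Qt x ^ 2 * 1 * (1 + u x ^ 2) := by
        gcongr
        rw [← sq_abs (u x)]
        nlinarith [sq_nonneg (|u x| - 1), abs_nonneg (u x)]
    _ = _ := by ring

lemma parityPart (h : HasFiniteEnergy u g) (s : ℝ) :
    HasFiniteEnergy (parityPart s u) (parityPart (-s) g) where
  hasDensity := hasDensity_parityPart h.hasDensity s
  memLp_density := memLp_parityPart h.memLp_density (-s)
  memLp_mul := by
    convert memLp_parityPart h.memLp_mul s using 1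
    ext x
    simp only [_root_.parityPart, Qt_neg]
    ring

lemma integral_Qt_sq_eq (h : HasFiniteEnergy u g) : ∫ x, Qt x ^ 2 * u x ^ 2 =
    2 * ((∫ x in Ioi 0, Qt x ^ 2 * _root_.parityPart 1 u x ^ 2) +
      ∫ x in Ioi 0, Qt x ^ 2 * _root_.parityPart (-1) u x ^ 2) := by
  rw [integral_eq_two_mul_parityPart h.integrable_Qt_sq, ← MeasureTheory.integral_add
    (h.parityPart 1).integrable_Qt_sq.integrableOn
    (h.parityPart (-1)).integrable_Qt_sq.integrableOn]
  refine congrArg (2 * ·) (MeasureTheory.integral_congr_ae (ae_of_all _ fun x => ?_))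
  simp only [_root_.parityPart, Qt_neg]
  ring

lemma integral_energy_eq (h : HasFiniteEnergy u g) :
    ∫ x, (g x ^ 2 - 2 / 3 * Qt x ^ 3 * u x ^ 2) =
    2 * ((∫ x in Ioi 0, (_root_.parityPart (-1) g x ^ 2 -
        2 / 3 * Qt x ^ 3 * _root_.parityPart 1 u x ^ 2)) +
      ∫ x in Ioi 0, (_root_.parityPart (- -1) g x ^ 2 -
        2 / 3 * Qt x ^ 3 * _root_.parityPart (-1) u x ^ 2)) := by
  rw [integral_eq_two_mul_parityPart h.integrable_energy, ← MeasureTheory.integral_add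
    (h.parityPart 1).integrable_energy.integrableOn
    (h.parityPart (-1)).integrable_energy.integrableOn]
  refine congrArg (2 * ·) (MeasureTheory.integral_congr_ae (ae_of_all _ fun x => ?_))
  simp only [_root_.parityPart, Qt_neg]
  ring

end HasFiniteEnergy

/-- A coercivity bound with the moment constraint on one parity. -/
lemma IsInnerSol.exists_parity_coercive {x₁ κ θ R₀ : ℝ} {w w' : ℝ → ℝ} (h : IsInnerSol x₁ w w')
    (hσ : Continuous σ) (hκ : 0 < κ) (hθ : θ < 1) (hβ : 0 < logDerivJump x₁ w w')
    (hR : ∀ R, R₀ ≤ R → κ ≤ splitMoment x₁ w σ R ∧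
      logDerivJump x₁ w w' * splitNormSq x₁ w σ R ≤ θ * splitMoment x₁ w σ R ^ 2)
    (hpar : ∀ x, σ (-x) = s * σ x) (hs : w' 0 = 0 ∨ s = -1) :
    ∃ C, 0 < C ∧ ∀ u g : ℝ → ℝ, HasFiniteEnergy u g → Integrable (fun x => σ x * u x) →
      ∫ x, σ x * u x = 0 →
      ∫ x in Ioi 0, Qt x ^ 2 * parityPart s u x ^ 2 ≤
        C * ∫ x in Ioi 0, (parityPart (-s) g x ^ 2 - 2 / 3 * Qt x ^ 3 * parityPart s u x ^ 2) := by
  obtain ⟨C, hC, hcoer⟩ := h.exists_coercive hσ hκ hθ hβ (fun R hR' => (hR R hR').1)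
    fun R hR' => (hR R hR').2
  refine ⟨C, hC, fun u g hu h_int h0 => ?_⟩
  have hp := hu.parityPart s
  exact hcoer _ _ hp.hasDensity hp.integrable_sq hp.integrable_Qt_sq hp.integrable_Qt_cube
    (integrable_mul_parityPart h_int hpar) (integral_mul_parityPart h_int h0 hpar)
    (hs.imp_right fun hs => by simp [parityPart, hs])

end Assembly

/-- Coercivity of the quadratic form of `L̃u = −u'' − (2/3)Q̃³u`
in the `H₀` norm under the two orthogonality conditions `⟨φ₀,u⟩ = 0` and
`⟨Q̃²H̃³,u⟩ = 0`. -/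
theorem tilde_L_coercivity (φ₀ : ℝ → ℝ) (μ₀ : ℝ)
    (hC2 : ContDiff ℝ 2 φ₀) (hpos : ∀ x : ℝ, 0 < φ₀ x)
    (heven : ∀ x : ℝ, φ₀ (-x) = φ₀ x)
    (hL2 : Integrable (fun x => (φ₀ x)^2))
    (hμ1 : (0.808:ℝ) ≤ μ₀) (hμ2 : μ₀ ≤ (0.883:ℝ))
    (heq : ∀ x : ℝ, -(deriv (deriv φ₀) x) + Vpot x * φ₀ x = -μ₀^2 * φ₀ x)
    (hdecay : ∃ C > (0:ℝ), ∀ x : ℝ,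
      |φ₀ x| + |deriv φ₀ x| ≤ C * Real.exp (-(Real.sqrt 2 / 2) * μ₀ * |x|)) :
    ∃ c₀ > (0:ℝ), ∀ u g : ℝ → ℝ,
      (∀ a b : ℝ, u b - u a = ∫ t in a..b, g t) →
      Integrable (fun x => (g x)^2) →
      Integrable (fun x => (Qt x * u x)^2) →
      (∫ x, φ₀ x * u x) = 0 →
      (∫ x, (Qt x)^2 * (Ht x)^3 * u x) = 0 →
      c₀ * ((∫ x, (g x)^2) + ∫ x, (Qt x)^2 * (u x)^2)
        ≤ (∫ x, (g x)^2) - (2/3) * ∫ x, (Qt x)^3 * (u x)^2 := by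
  obtain ⟨C, -, hdecay⟩ := hdecay
  have hk : 0 < √2 / 2 * μ₀ := by positivity
  have hd : ∀ x, |φ₀ x| + |deriv φ₀ x| ≤ C * exp (-(√2 / 2 * μ₀) * |x|) := fun x => by
    simpa only [neg_mul] using hdecay x
  have hφd : ∀ x, |φ₀ x| ≤ C * exp (-(√2 / 2 * μ₀) * |x|) := fun x =>
    (le_add_of_nonneg_right (abs_nonneg _)).trans (hd x)
  have hgs := isGroundState_of_decay hC2 hpos heven hμ1 heq hk fun x =>
    (le_add_of_nonneg_left (abs_nonneg _)).trans (hd x)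
  have hφc := hC2.continuous
  have hφint := integrable_of_decay hφc hk hφd
  obtain ⟨Ce, hCe, heven_coer⟩ : ∃ C, 0 < C ∧ ∀ u g : ℝ → ℝ, HasFiniteEnergy u g →
      Integrable (fun x => φ₀ x * u x) → ∫ x, φ₀ x * u x = 0 →
      ∫ x in Ioi 0, Qt x ^ 2 * parityPart 1 u x ^ 2 ≤ C * ∫ x in Ioi 0,
        (parityPart (-1) g x ^ 2 - 2 / 3 * Qt x ^ 3 * parityPart 1 u x ^ 2) := by
    obtain ⟨x₁, κ, θ, R₀, hw, hβ, hκ, hθ, hR⟩ := hgs.exists_moment_bound hφint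
    exact hw.exists_parity_coercive hφc hκ hθ hβ hR (fun x => by rw [heven, one_mul])
      (Or.inl evenSolDeriv_zero)
  obtain ⟨Co, hCo, hodd_coer⟩ : ∃ C, 0 < C ∧ ∀ u g : ℝ → ℝ, HasFiniteEnergy u g →
      Integrable (fun x => Qt x ^ 2 * Ht x ^ 3 * u x) → ∫ x, Qt x ^ 2 * Ht x ^ 3 * u x = 0 →
      ∫ x in Ioi 0, Qt x ^ 2 * parityPart (-1) u x ^ 2 ≤ C * ∫ x in Ioi 0,
        (parityPart (- -1) g x ^ 2 - 2 / 3 * Qt x ^ 3 * parityPart (-1) u x ^ 2) := by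
    obtain ⟨x₁, κ, θ, R₀, w, w', hw, hβ, hκ, hθ, hR⟩ := exists_odd_moment_bound
    exact hw.exists_parity_coercive continuous_oddWeight hκ hθ hβ hR
      (fun x => by rw [Qt_neg, Ht_neg]; ring) (Or.inr rfl)
  refine ⟨1 / (1 + 2 * (Ce + Co)), by positivity, fun u g hug hg hu hφu hQu => ?_⟩
  rw [one_div, inv_mul_le_iff₀ (by positivity)]
  obtain h | ⟨k, hconst⟩ := hasDensity_or_const hug
  · have hfe := HasFiniteEnergy.of_integrable h hg hu
    have he := heven_coer u g hfe (h.integrable_mul hg hφc hk hφd) hφu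
    have ho := hodd_coer u g hfe hfe.integrable_oddWeight_mul hQu
    have hY := hfe.integral_Qt_sq_eq
    have hW := hfe.integral_energy_eq
    have hW' : ∫ x, (g x ^ 2 - 2 / 3 * Qt x ^ 3 * u x ^ 2) =
        (∫ x, g x ^ 2) - 2 / 3 * ∫ x, Qt x ^ 3 * u x ^ 2 := by
      rw [← MeasureTheory.integral_const_mul,
        ← MeasureTheory.integral_sub hg (hfe.integrable_Qt_cube.const_mul _)]
      simp only [mul_assoc]
    have hZ : ∫ x, Qt x ^ 3 * u x ^ 2 ≤ 3 / 2 * ∫ x, Qt x ^ 2 * u x ^ 2 := by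
      rw [← MeasureTheory.integral_const_mul]
      exact MeasureTheory.integral_mono hfe.integrable_Qt_cube
        (hfe.integrable_Qt_sq.const_mul _) HasFiniteEnergy.Qt_cube_le
    have hnonneg : ∀ s, 0 ≤ ∫ x in Ioi 0, Qt x ^ 2 * parityPart s u x ^ 2 := fun s =>
      integral_nonneg fun x => by positivity
    have hEe := nonneg_of_mul_nonneg_right ((hnonneg 1).trans he) hCe
    have hEo := nonneg_of_mul_nonneg_right ((hnonneg (-1)).trans ho) hCo
    rw [hW'] at hW
    nlinarith [mul_nonneg hCe.le hEo, mul_nonneg hCo.le hEe]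
  · have hk0 : k = 0 := by
      have hpos_int : 0 < ∫ x, φ₀ x :=
        integral_pos_of_integrable_nonneg_nonzero hφc hφint (fun x => (hpos x).le) (hpos 0).ne'
      simp only [hconst, MeasureTheory.integral_mul_const] at hφu
      exact (mul_eq_zero.1 hφu).resolve_left hpos_int.ne'
    have hX : 0 ≤ ∫ x, g x ^ 2 := integral_nonneg fun x => sq_nonneg _
    simp only [hconst, hk0, ne_eq, OfNat.ofNat_ne_zero, not_false_eq_true, zero_pow, mul_zero,
      MeasureTheory.integral_zero, add_zero, sub_zero]
    nlinarith [mul_nonneg hCe.le hX, mul_nonneg hCo.le hX]
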